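/- arXiv:2212.10649 — 2 statements merged into one kernel-verified Lean document; each statement's English description precedes it below -/
import Mathlib

section
/- Let G=(N,E) and G'=(N,E') be DAGs on the same node set, with each state space X_s having at least two elements. Then P^{G'} ⊇ P^G if and only if for every s ∈ N, {s} ⊥_G nd_{G'}(s) | pa_{G'}(s). -/
open Finset

/-! Basic graph-theoretic definitions for Bayesian networks. -/

/-- Two nodes are joined (adjacent) in the directed graph `E`. -/
def GJoined {V : Type*} (E : V → V → Prop) (a b : V) : Prop := E a b ∨ E b a

/-- A directed graph (given by its edge relation) is a DAG iff it has no cycles: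
no node can reach itself by a nonempty directed walk. -/
def IsDAG {V : Type*} (E : V → V → Prop) : Prop := ∀ s, ¬ Relation.TransGen E s s

/-- The set of parents of `s`. -/
def paG {V : Type*} (E : V → V → Prop) (s : V) : Set V := {t | E t s}

/-- The set of children of `s`. -/
def chG {V : Type*} (E : V → V → Prop) (s : V) : Set V := {t | E s t}

/-- The set of descendants of `s` (nodes reachable from `s` by a nonempty directed path). -/
def desG {V : Type*} (E : V → V → Prop) (s : V) : Set V := {t | Relation.TransGen E s t}

/-- A set of nodes is complete if all pairs of distinct elements are joined. -/
def GComplete {V : Type*} (E : V → V → Prop) (S : Set V) : Prop :=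
  ∀ a ∈ S, ∀ b ∈ S, a ≠ b → GJoined E a b

/-- A directed graph is perfect if the parent set of every node is complete. -/
def GPerfect {V : Type*} (E : V → V → Prop) : Prop := ∀ s, GComplete E (paG E s)

/-- `a` and `b` are joined in the moral graph `G^M` of `E`:
either joined in `E` or distinct common parents of some node. -/
def MoralEdge {V : Type*} (E : V → V → Prop) (a b : V) : Prop :=
  E a b ∨ E b a ∨ (a ≠ b ∧ ∃ s, E a s ∧ E b s)

/-- A topological ordering of a graph on a finite node set: an injective map into
`{1, …, |N|}` (encoded as `Fin (card V)`) increasing along edges. -/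
def IsTopo {V : Type*} [Fintype V] (E : V → V → Prop) (O : V → Fin (Fintype.card V)) : Prop :=
  Function.Injective O ∧ ∀ s t, E s t → O s < O t

/-! d-separation. -/

/-- `u` is a v-structure (collider) of the trail `l` in the graph `E`. -/
def VStruct {V : Type*} (E : V → V → Prop) (l : List V) (u : V) : Prop :=
  ∃ l₁ l₂ a b, l = l₁ ++ a :: u :: b :: l₂ ∧ E a u ∧ E b u

/-- `l` is a trail in the graph `E`: a nonempty sequence of distinct nodes consecutively joined. -/
def IsTrail {V : Type*} (E : V → V → Prop) (l : List V) : Prop :=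
  l ≠ [] ∧ l.Nodup ∧ l.Chain' (GJoined E)

/-- The trail `l` is blocked by `S`. -/
def BlockedBy {V : Type*} (E : V → V → Prop) (S : Set V) (l : List V) : Prop :=
  ∃ u ∈ l, (u ∈ S ∧ ¬ VStruct E l u) ∨
    (VStruct E l u ∧ u ∉ S ∧ ∀ t ∈ desG E u, t ∉ S)

/-- d-separation: every trail from a node of `A` to a node of `B` is blocked by `S`. -/
def DSep {V : Type*} (E : V → V → Prop) (A B S : Set V) : Prop :=
  ∀ (l : List V) (a b : V), IsTrail E l → l.head? = some a → l.getLast? = some b →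
    a ∈ A → b ∈ B → BlockedBy E S l

/-- The set of leaves (childless nodes), as a `Finset`. -/
def leavesF {V : Type*} [Fintype V] (E : V → V → Prop) [DecidableRel E] : Finset V :=
  Finset.univ.filter fun s => ∀ t, ¬ E s t

/-! Probability on graphs (finite state spaces, pmfs). -/

section Prob

variable {V : Type*} [Fintype V] [DecidableEq V]
variable (X : V → Type*) [∀ v, Fintype (X v)]

/-- `p` is a probability mass function on `X_N = ∏ v, X v`. -/
def IsPMF (p : (∀ v, X v) → ℝ) : Prop :=
  (∀ x, 0 ≤ p x) ∧ ∑ x, p x = 1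

/-- `k` is a kernel function for the node `s` w.r.t. the graph `E`: it is nonnegative,
depends on the configuration only through the parents of `s` in `E`, and is normalized. -/
def IsKernel (E : V → V → Prop) (s : V) (k : X s → (∀ v, X v) → ℝ) : Prop :=
  (∀ a x, 0 ≤ k a x) ∧
  (∀ a x y, (∀ t, E t s → x t = y t) → k a x = k a y) ∧
  (∀ x, ∑ a, k a x = 1)

/-- `p` factorizes over the graph `E`: it is a product of kernel functions, one per node. -/
def Factorizes (E : V → V → Prop) (p : (∀ v, X v) → ℝ) : Prop :=
  ∃ k : ∀ s, X s → (∀ v, X v) → ℝ,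
    (∀ s, IsKernel X E s (k s)) ∧ ∀ x, p x = ∏ s, k s (x s) x

variable [∀ v, DecidableEq (X v)]

/-- The marginal of `p` on the coordinates in `C`, evaluated at (the `C`-part of) `x`. -/
def marg (p : (∀ v, X v) → ℝ) (C : Finset V) (x : ∀ v, X v) : ℝ :=
  ∑ y, if ∀ v ∈ C, y v = x v then p y else 0

/-- Conditional independence `A ⟂⟂ B ∣ S` w.r.t. the pmf `p`. -/
def CondIndep (p : (∀ v, X v) → ℝ) (A B S : Finset V) : Prop :=
  ∀ x, 0 < marg X p S x →
    marg X p (A ∪ B ∪ S) x * marg X p S x = marg X p (A ∪ S) x * marg X p (B ∪ S) x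

/-- `q` is a conditional system for `N ∖ A` given `A`: a family of pmfs on `X_{N∖A}`,
one for every configuration on `A`.  Here `q x` encodes `q(x_{N∖A} ∣ x_A)`. -/
def IsCondSystem (A : Finset V) (q : (∀ v, X v) → ℝ) : Prop :=
  (∀ x, 0 ≤ q x) ∧ ∀ x : ∀ v, X v, (∑ y, if ∀ v ∈ A, y v = x v then q y else 0) = 1

/-- The conditional system `q` for `N ∖ A` given `A` factorizes over the graph `E`. -/
def CondFactorizes (E : V → V → Prop) (A : Finset V) (q : (∀ v, X v) → ℝ) : Prop :=
  ∃ k : ∀ s, X s → (∀ v, X v) → ℝ,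
    (∀ s ∉ A, IsKernel X E s (k s)) ∧ ∀ x, q x = ∏ s ∈ Finset.univ \ A, k s (x s) x

/-- The conditional system `q` for `N ∖ A` given `A` is a version of the conditional
distribution of the pmf `p`. -/
def IsVersionOf (A : Finset V) (q p : (∀ v, X v) → ℝ) : Prop :=
  ∀ x, p x = q x * marg X p A x

/-- `G'` (edges `E'`) satisfies Goal I for `G` (edges `E`): `roots(G') ⊇ leaves(G)` and for
every pmf factorizing over `G` there is a conditional system for `N ∖ leaves(G)` given
`leaves(G)` factorizing over `G'` which is a version of its conditional distribution. -/
def GoalI (E E' : V → V → Prop) [DecidableRel E] : Prop :=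
  (∀ s ∈ leavesF E, ∀ t, ¬ E' t s) ∧
  ∀ p : (∀ v, X v) → ℝ, IsPMF X p → Factorizes X E p →
    ∃ q, IsCondSystem X (leavesF E) q ∧ CondFactorizes X E' (leavesF E) q ∧
      IsVersionOf X (leavesF E) q p

/-- `G'` (edges `E'`) satisfies Goal II for `G` (edges `E`): `P^{G'} ⊇ P^G` and every parent
in `G'` of a leaf of `G` is itself a leaf of `G`. -/
def GoalII (E E' : V → V → Prop) : Prop :=
  (∀ p : (∀ v, X v) → ℝ, IsPMF X p → Factorizes X E p → Factorizes X E' p) ∧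
  ∀ s t, (∀ u, ¬ E s u) → E' t s → ∀ u, ¬ E t u

end Prob

section SumOut

open scoped Classical in
/-- The sum of `F` over the coordinates in `D`, the others being held fixed. -/
noncomputable def sumOut {V : Type*} [Fintype V] [DecidableEq V] {X : V → Type*}
    [∀ v, Fintype (X v)] (D : Finset V) (F : (∀ v, X v) → ℝ) (x : ∀ v, X v) : ℝ :=
  ∑ y, if ∀ v ∉ D, y v = x v then F y else 0

/-- `F` does not depend on the coordinates in `D`. -/
def IndepOf {V : Type*} {X : V → Type*} (D : Finset V) (F : (∀ v, X v) → ℝ) : Prop :=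
  ∀ x y, (∀ v ∉ D, x v = y v) → F x = F y

theorem IndepOf.mono {V : Type*} {X : V → Type*} {D D' : Finset V} {F : (∀ v, X v) → ℝ}
    (hF : IndepOf D' F) (h : D ⊆ D') : IndepOf D F :=
  fun x y hxy => hF x y fun v hv => hxy v fun hv' => hv (h hv')

variable {V : Type*} [Fintype V] [DecidableEq V] {X : V → Type*} [∀ v, Fintype (X v)]

theorem sumOut_empty (F : (∀ v, X v) → ℝ) (x : ∀ v, X v) : sumOut ∅ F x = F x := by
  classical
  simp [sumOut, ← funext_iff]

theorem sumOut_univ (F : (∀ v, X v) → ℝ) (x : ∀ v, X v) :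
    sumOut Finset.univ F x = ∑ y, F y := by
  simp [sumOut]

theorem sumOut_nonneg {F : (∀ v, X v) → ℝ} (hF : ∀ x, 0 ≤ F x) (D : Finset V) (x : ∀ v, X v) :
    0 ≤ sumOut D F x :=
  Finset.sum_nonneg fun y _ => by split_ifs <;> simp [hF]

theorem sumOut_mono {F : (∀ v, X v) → ℝ} (hF : ∀ x, 0 ≤ F x) {D D' : Finset V} (h : D ⊆ D')
    (x : ∀ v, X v) : sumOut D F x ≤ sumOut D' F x := by
  refine Finset.sum_le_sum fun y _ => ?_
  by_cases h1 : ∀ v ∉ D, y v = x v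
  · have h2 : ∀ v ∉ D', y v = x v := fun v hv => h1 v fun hv' => hv (h hv')
    rw [if_pos h1, if_pos h2]
  · rw [if_neg h1]
    split_ifs <;> simp [hF]

theorem sumOut_union {A B : Finset V} (hAB : Disjoint A B) (F : (∀ v, X v) → ℝ)
    (x : ∀ v, X v) : sumOut (A ∪ B) F x = sumOut A (sumOut B F) x := by
  classical
  unfold sumOut
  simp_rw [← Finset.sum_filter, Finset.sum_filter]
  have h1 : ∀ z : ∀ v, X v,
      (if ∀ v ∉ A, z v = x v then ∑ y, if ∀ v ∉ B, y v = z v then F y else 0 else 0)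
      = ∑ y, if z = (fun v => if v ∈ A then y v else x v) then
          (if ∀ v ∉ A ∪ B, y v = x v then F y else 0) else 0 := by
    intro z
    split_ifs with hz
    · refine Finset.sum_congr rfl fun y _ => ?_
      have : (∀ v ∉ B, y v = z v) ↔
          (z = (fun v => if v ∈ A then y v else x v) ∧ ∀ v ∉ A ∪ B, y v = x v) := by
        constructor
        · intro h
          refine ⟨funext fun v => ?_, fun v hv => ?_⟩
          · by_cases hv : v ∈ A
            · simp [hv, h v (Finset.disjoint_left.1 hAB hv)]
            · simp [hv, hz v hv]
          · simp only [Finset.mem_union, not_or] at hv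
            rw [h v hv.2, hz v hv.1]
        · rintro ⟨h, h'⟩ v hv
          rw [h]
          by_cases hvA : v ∈ A
          · simp [hvA]
          · simp [hvA, h' v (by simp [hv, hvA])]
      rw [← ite_and]
      exact if_congr this rfl rfl
    · refine (Finset.sum_eq_zero fun y _ => ?_).symm
      rw [if_neg]
      rintro rfl
      exact hz fun v hv => by simp [hv]
  rw [Finset.sum_congr rfl fun z _ => h1 z, Finset.sum_comm]
  refine Finset.sum_congr rfl fun y _ => ?_
  simp

theorem sumOut_insert {D : Finset V} {v : V} (hv : v ∉ D) (F : (∀ v, X v) → ℝ) (x : ∀ v, X v) :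
    sumOut (insert v D) F x = ∑ a, sumOut D F (Function.update x v a) := by
  classical
  unfold sumOut
  rw [Finset.sum_comm]
  refine Finset.sum_congr rfl fun y _ => ?_
  have : ∀ a, (∀ w ∉ D, y w = Function.update x v a w) ↔
      (a = y v ∧ ∀ w ∉ insert v D, y w = x w) := by
    intro a
    constructor
    · intro h
      refine ⟨by simpa using (h v hv).symm, fun w hw => ?_⟩
      simp only [Finset.mem_insert, not_or] at hw
      rw [h w hw.2, Function.update_of_ne hw.1]
    · rintro ⟨rfl, h⟩ w hw
      by_cases hwv : w = v
      · subst hwv; simp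
      · rw [Function.update_of_ne hwv, h w (by simp [hw, hwv])]
  simp_rw [this, ite_and]
  simp

theorem sumOut_mul_left {D : Finset V} {F : (∀ v, X v) → ℝ} (hF : IndepOf D F)
    (G : (∀ v, X v) → ℝ) (x : ∀ v, X v) :
    sumOut D (fun y => F y * G y) x = F x * sumOut D G x := by
  unfold sumOut
  rw [Finset.mul_sum]
  refine Finset.sum_congr rfl fun y _ => ?_
  split_ifs with h
  · simp only [hF y x h]
  · simp

theorem indepOf_sumOut_self (D : Finset V) (F : (∀ v, X v) → ℝ) : IndepOf D (sumOut D F) := by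
  intro x y hxy
  unfold sumOut
  congr! 3 with z _ v
  exact imp_congr_right fun hv => by rw [hxy v hv]

theorem IndepOf.sumOut {A B : Finset V} (hAB : Disjoint A B) {F : (∀ v, X v) → ℝ}
    (hF : IndepOf A F) : IndepOf A (sumOut B F) := by
  intro x x' hxx'
  unfold _root_.sumOut
  rw [← Finset.sum_filter, ← Finset.sum_filter]
  have key : ∀ x x' : ∀ v, X v, (∀ v ∉ A, x v = x' v) → ∀ y : ∀ v, X v,
      (∀ v ∉ B, y v = x v) → ∀ v ∉ B, (fun v => if v ∈ A then x' v else y v) v = x' v := by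
    intro x x' hxx' y hy v hv
    by_cases hvA : v ∈ A
    · simp [hvA]
    · simp [hvA, hy v hv, hxx' v hvA]
  have inv : ∀ x x' : ∀ v, X v, ∀ y : ∀ v, X v,
      (∀ v ∉ B, y v = x v) → (fun v => if v ∈ A then x v else
        (fun v => if v ∈ A then x' v else y v) v) = y := by
    intro x x' y hy
    funext v
    by_cases hvA : v ∈ A
    · simp [hvA, hy v (Finset.disjoint_left.1 hAB hvA)]
    · simp [hvA]
  refine Finset.sum_bij' (fun y _ v => if v ∈ A then x' v else y v)
    (fun y _ v => if v ∈ A then x v else y v) ?_ ?_ ?_ ?_ ?_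
  · intro y hy
    simpa using key x x' hxx' y (by simpa using hy)
  · intro y hy
    simpa using key x' x (fun v hv => (hxx' v hv).symm) y (by simpa using hy)
  · intro y hy
    exact inv x x' y (by simpa using hy)
  · intro y hy
    exact inv x' x y (by simpa using hy)
  · intro y hy
    exact hF _ _ fun v hv => by simp [hv]

end SumOut

section Kernels

variable {V : Type*} {E : V → V → Prop}

theorem IsDAG.swap (hE : IsDAG E) : IsDAG (Function.swap E) := fun s h =>
  hE s (Relation.transGen_swap.1 h)

theorem IsDAG.irrefl (hE : IsDAG E) (v : V) : ¬ E v v := fun h => hE v (.single h)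

theorem IsDAG.asymm (hE : IsDAG E) {v w : V} (h : E v w) : ¬ E w v := fun h' =>
  hE v (.tail (.single h) h')

variable [Fintype V]

theorem IsDAG.exists_source (hE : IsDAG E) {D : Finset V} (hD : D.Nonempty) :
    ∃ v ∈ D, ∀ w ∈ D, ¬ E w v := by
  have : IsTrans V (Relation.TransGen E) := ⟨fun _ _ _ => Relation.TransGen.trans⟩
  have : Std.Irrefl (Relation.TransGen E) := ⟨hE⟩
  have wf : WellFounded (Relation.TransGen E) := Finite.wellFounded_of_trans_of_irrefl _
  obtain ⟨v, hv, h⟩ := wf.has_min (D : Set V) hD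
  exact ⟨v, hv, fun w hw hwv => h w hw (.single hwv)⟩

variable [DecidableEq V] {X : V → Type*} [∀ v, Fintype (X v)]
  {k : ∀ s, X s → (∀ v, X v) → ℝ}

theorem sumOut_prod_kernel (hE : IsDAG E) (hk : ∀ s, IsKernel X E s (k s)) (D : Finset V)
    (x : ∀ v, X v) : sumOut D (fun y => ∏ v ∈ D, k v (y v) y) x = 1 := by
  classical
  induction hn : D.card generalizing D x with
  | zero =>
    obtain rfl := Finset.card_eq_zero.1 hn
    simp [sumOut_empty]
  | succ n ih =>
    obtain ⟨v, hvD, hv⟩ := hE.exists_source (Finset.card_pos.1 (by omega : 0 < D.card))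
    obtain ⟨D, hvD', rfl⟩ : ∃ D', v ∉ D' ∧ D = insert v D' :=
      ⟨D.erase v, by simp, (Finset.insert_erase hvD).symm⟩
    rw [Finset.card_insert_of_notMem hvD'] at hn
    rw [sumOut_insert hvD', ← (hk v).2.2 x]
    refine Finset.sum_congr rfl fun a _ => ?_
    simp_rw [Finset.prod_insert hvD']
    have h1 : sumOut D (fun y => k v (y v) y * ∏ w ∈ D, k w (y w) y) (Function.update x v a)
        = sumOut D (fun y => k v a x * ∏ w ∈ D, k w (y w) y) (Function.update x v a) := by
      refine Finset.sum_congr rfl fun y _ => ?_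
      split_ifs with h
      · have h2 : y v = a := by rw [h v hvD']; simp
        have h3 : k v a y = k v a x := by
          refine (hk v).2.1 a y x fun t ht => ?_
          have htv : t ≠ v := by rintro rfl; exact hE.irrefl _ ht
          rw [h t fun htD => hv t (by simp [htD]) ht, Function.update_of_ne htv]
        simp only [h2, h3]
      · rfl
    rw [h1, sumOut_mul_left (fun _ _ _ => rfl), ih D _ (by omega), mul_one]

theorem isPMF_prod_kernel [Nonempty (∀ v, X v)] (hE : IsDAG E)
    (hk : ∀ s, IsKernel X E s (k s)) : IsPMF X (fun x => ∏ s, k s (x s) x) := by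
  refine ⟨fun x => Finset.prod_nonneg fun s _ => (hk s).1 _ _, ?_⟩
  rw [← sumOut_univ _ (Classical.arbitrary _)]
  exact sumOut_prod_kernel hE hk _ _

theorem exists_factorizes_support (hE : IsDAG E) (C : ∀ v, X v → (∀ v, X v) → Prop)
    (hC : ∀ v a x y, (∀ t, E t v → x t = y t) → (C v a x ↔ C v a y))
    (hne : ∀ v x, ∃ a, C v a x) [Nonempty (∀ v, X v)] :
    ∃ p, IsPMF X p ∧ Factorizes X E p ∧ ∀ x, 0 < p x ↔ ∀ v, C v (x v) x := by
  classical
  let k : ∀ s, X s → (∀ v, X v) → ℝ := fun s a x =>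
    if C s a x then ((Finset.univ.filter fun b => C s b x).card : ℝ)⁻¹ else 0
  have hcard : ∀ s x, (0 : ℝ) < (Finset.univ.filter fun b => C s b x).card := by
    intro s x
    obtain ⟨a, ha⟩ := hne s x
    exact_mod_cast Finset.card_pos.2 ⟨a, by simpa using ha⟩
  have hk : ∀ s, IsKernel X E s (k s) := by
    refine fun s => ⟨fun a x => ?_, fun a x y h => ?_, fun x => ?_⟩
    · simp only [k]
      split_ifs <;> positivity
    · simp only [k, hC s _ x y h]
    · simp only [k, ← Finset.sum_filter, Finset.sum_const, nsmul_eq_mul]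
      exact mul_inv_cancel₀ (hcard s x).ne'
  refine ⟨_, isPMF_prod_kernel hE hk, ⟨k, hk, fun _ => rfl⟩, fun x => ⟨fun h v => ?_, fun h => ?_⟩⟩
  · by_contra hv
    exact h.ne' (Finset.prod_eq_zero (Finset.mem_univ v) (by simp [k, hv]))
  · refine Finset.prod_pos fun v _ => ?_
    simp only [k, h v, if_true]
    exact inv_pos.2 (hcard v x)

theorem Factorizes.exists_support_swap (hE : IsDAG E) {p : (∀ v, X v) → ℝ}
    (hp : Factorizes X E p) {s : V} {x y : ∀ v, X v} (hx : 0 < p x) (hy : 0 < p y)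
    (hxy : ∀ t, E t s → x t = y t) :
    ∃ z, 0 < p z ∧ z s = x s ∧ ∀ t, t ≠ s → ¬ Relation.TransGen E s t → z t = y t := by
  classical
  obtain ⟨k, hk, hpk⟩ := hp
  have pos : ∀ x, 0 < p x → ∀ v, 0 < k v (x v) x := by
    intro x hx v
    refine lt_of_le_of_ne ((hk v).1 _ _) fun h => hx.ne' ?_
    rw [hpk]
    exact Finset.prod_eq_zero (Finset.mem_univ v) h.symm
  let D : Finset V := Finset.univ.filter fun t => Relation.TransGen E s t
  obtain ⟨z, hz, hzD⟩ : ∃ z : ∀ v, X v, (∀ v ∉ D, z v = Function.update y s (x s) v) ∧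
      ∀ v ∈ D, k v (z v) z ≠ 0 := by
    by_contra! hcon
    have h1 := sumOut_prod_kernel hE hk D (Function.update y s (x s))
    rw [sumOut, Finset.sum_eq_zero] at h1
    · exact zero_ne_one h1
    · intro z _
      split_ifs with h
      · obtain ⟨v, hv, hv0⟩ := hcon z h
        exact Finset.prod_eq_zero hv hv0
      · rfl
  have hsD : s ∉ D := by simpa [D] using hE s
  have hznd : ∀ t, t ≠ s → ¬ Relation.TransGen E s t → z t = y t := by
    intro t hts ht
    rw [hz t (by simpa [D] using ht), Function.update_of_ne hts]
  have hzs : z s = x s := by rw [hz s hsD]; simp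
  refine ⟨z, ?_, hzs, hznd⟩
  rw [hpk]
  refine Finset.prod_pos fun v _ => ?_
  by_cases hvD : v ∈ D
  · exact lt_of_le_of_ne ((hk v).1 _ _) (hzD v hvD).symm
  · by_cases hvs : v = s
    · subst hvs
      rw [hzs, (hk v).2.1 _ z x fun t ht => ?_]
      · exact pos x hx v
      · rw [hznd t (by rintro rfl; exact hE.irrefl _ ht) fun h => hE v (h.tail ht), hxy t ht]
    · have hv : ¬ Relation.TransGen E s v := by simpa [D] using hvD
      rw [hznd v hvs hv, (hk v).2.1 _ z y fun t ht => ?_]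
      · exact pos y hy v
      · refine hznd t ?_ fun h => hv (h.tail ht)
        rintro rfl
        exact hv (.single ht)

end Kernels

section Ball

/-- The nodes reached by the Bayes ball started in `B` with observed set `S`. The flag is `true`
when the ball leaves the node as if it came from a child, `false` when it came from a parent. -/
inductive BallReach {V : Type*} (E : V → V → Prop) (S B : Set V) : V → Bool → Prop
  | start {b : V} (hb : b ∈ B) : BallReach E S B b true
  | up_up {v w : V} (hv : BallReach E S B v true) (hS : v ∉ S) (hw : E w v) :
      BallReach E S B w true
  | up_down {v w : V} (hv : BallReach E S B v true) (hS : v ∉ S) (hw : E v w) :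
      BallReach E S B w false
  | down_down {v w : V} (hv : BallReach E S B v false) (hS : v ∉ S) (hw : E v w) :
      BallReach E S B w false
  | down_up {v w : V} (hv : BallReach E S B v false) (hS : v ∈ S) (hw : E w v) :
      BallReach E S B w true

theorem indepOf_prod_kernel {V : Type*} {X : V → Type*} [∀ v, Fintype (X v)]
    {E : V → V → Prop} {k : ∀ s, X s → (∀ v, X v) → ℝ}
    (hk : ∀ s, IsKernel X E s (k s)) {D K : Finset V}
    (h : ∀ v ∈ K, v ∉ D ∧ ∀ t, E t v → t ∉ D) :
    IndepOf D (fun y => ∏ v ∈ K, k v (y v) y) := by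
  intro x y hxy
  refine Finset.prod_congr rfl fun v hv => ?_
  rw [hxy v (h v hv).1]
  exact (hk v).2.1 _ x y fun t ht => hxy t ((h v hv).2 t ht)

variable {V : Type*} [Fintype V] [DecidableEq V] {X : V → Type*} [∀ v, Fintype (X v)]

theorem sumOut_mul_mul {A B D S : Finset V} (hABd : Disjoint A B) (hADd : Disjoint A D)
    (hBDd : Disjoint B D) (hS : ∀ v, v ∈ S ↔ v ∉ A ∧ v ∉ B ∧ v ∉ D)
    {F G H : (∀ v, X v) → ℝ} (hF : IndepOf (B ∪ D) F) (hG : IndepOf (A ∪ D) G)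
    (hH : ∀ x, sumOut D H x = 1) {C₁ C₂ : Finset V} (h₁ : C₁ ⊆ A) (h₂ : C₂ ⊆ B)
    (x : ∀ v, X v) :
    sumOut (C₁ ∪ C₂ ∪ S)ᶜ (fun y => F y * G y * H y) x =
      sumOut (A \ C₁) F x * sumOut (B \ C₂) G x := by
  have hset : (C₁ ∪ C₂ ∪ S)ᶜ = (A \ C₁) ∪ ((B \ C₂) ∪ D) := by
    ext v
    have := hS v
    have := @h₁ v
    have := @h₂ v
    have := @Finset.disjoint_left.1 hABd v
    have := @Finset.disjoint_left.1 hADd v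
    have := @Finset.disjoint_left.1 hBDd v
    simp only [Finset.mem_compl, Finset.mem_union, Finset.mem_sdiff]
    tauto
  have hB' : Disjoint (B \ C₂) D := hBDd.mono_left Finset.sdiff_subset
  have hA' : Disjoint (A \ C₁) ((B \ C₂) ∪ D) :=
    (Finset.disjoint_union_right.2 ⟨hABd.mono_right Finset.sdiff_subset, hADd⟩).mono_left
      Finset.sdiff_subset
  rw [hset, sumOut_union hA']
  have e1 : sumOut D (fun y => F y * G y * H y) = fun y => F y * G y := by
    funext y
    have hFG : IndepOf D (fun y => F y * G y) := fun y z hyz => by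
      simp only [hF.mono Finset.subset_union_right y z hyz,
        hG.mono Finset.subset_union_right y z hyz]
    rw [sumOut_mul_left hFG, hH, mul_one]
  have e2 : sumOut ((B \ C₂) ∪ D) (fun y => F y * G y * H y) =
      fun y => sumOut (B \ C₂) G y * F y := by
    funext y
    rw [sumOut_union hB', e1, sumOut_mul_left (hF.mono ?_), mul_comm]
    exact Finset.sdiff_subset.trans Finset.subset_union_left
  rw [e2, sumOut_mul_left, mul_comm]
  refine IndepOf.sumOut (hABd.mono Finset.sdiff_subset Finset.sdiff_subset) (hG.mono ?_)
  exact Finset.sdiff_subset.trans Finset.subset_union_left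

/-- A node that is not reached by the Bayes ball started in `B` is conditionally independent of
`B` given the observed set `S`. -/
theorem sumOut_mul_eq_of_not_ballReach {E : V → V → Prop} (hE : IsDAG E)
    {k : ∀ s, X s → (∀ v, X v) → ℝ} (hk : ∀ s, IsKernel X E s (k s)) {S B : Finset V}
    (hBS : Disjoint B S) {s : V} (hsS : s ∉ S) (hs : ∀ d, ¬ BallReach E S B s d) (x : ∀ v, X v) :
    sumOut (insert s (B ∪ S))ᶜ (fun y => ∏ v, k v (y v) y) x *
        sumOut Sᶜ (fun y => ∏ v, k v (y v) y) x =
      sumOut (insert s S)ᶜ (fun y => ∏ v, k v (y v) y) x *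
        sumOut (B ∪ S)ᶜ (fun y => ∏ v, k v (y v) y) x := by
  classical
  let R := BallReach E (S : Set V) (B : Set V)
  let A : Finset V := Finset.univ.filter fun v => v ∉ S ∧ R v true
  let U : Finset V := Finset.univ.filter fun v => v ∉ S ∧ ¬ R v true ∧ ¬ R v false
  let D : Finset V := Finset.univ.filter fun v => v ∉ S ∧ ¬ R v true ∧ R v false
  let KA : Finset V := Finset.univ.filter fun v => (v ∉ S ∧ R v true) ∨ (v ∈ S ∧ R v false)
  let KU : Finset V := Finset.univ.filter fun v =>
    (v ∉ S ∧ ¬ R v true ∧ ¬ R v false) ∨ (v ∈ S ∧ ¬ R v false)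
  have up_up : ∀ {v w}, R v true → v ∉ S → E w v → R w true := fun h h' => .up_up h h'
  have up_down : ∀ {v w}, R v true → v ∉ S → E v w → R w false := fun h h' => .up_down h h'
  have down_down : ∀ {v w}, R v false → v ∉ S → E v w → R w false := fun h h' => .down_down h h'
  have down_up : ∀ {v w}, R v false → v ∈ S → E w v → R w true := fun h h' => .down_up h h'
  have hp : (fun y : ∀ v, X v => ∏ v, k v (y v) y) = fun y =>
      (∏ v ∈ KA, k v (y v) y) * (∏ v ∈ KU, k v (y v) y) * ∏ v ∈ D, k v (y v) y := by
    funext y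
    rw [← Finset.prod_union, ← Finset.prod_union]
    · refine Finset.prod_congr ?_ fun _ _ => rfl
      ext v
      simp only [KA, KU, D, Finset.mem_union, Finset.mem_filter, Finset.mem_univ, true_and]
      tauto
    · rw [Finset.disjoint_left]
      intro v
      simp only [KA, KU, D, Finset.mem_union, Finset.mem_filter, Finset.mem_univ, true_and]
      tauto
    · rw [Finset.disjoint_left]
      intro v
      simp only [KA, KU, Finset.mem_filter, Finset.mem_univ, true_and]
      tauto
  have key : ∀ C₁ C₂ : Finset V, C₁ ⊆ A → C₂ ⊆ U → ∀ x,
      sumOut (C₁ ∪ C₂ ∪ S)ᶜ (fun y => ∏ v, k v (y v) y) x =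
      sumOut (A \ C₁) (fun y => ∏ v ∈ KA, k v (y v) y) x *
        sumOut (U \ C₂) (fun y => ∏ v ∈ KU, k v (y v) y) x := by
    intro C₁ C₂ h₁ h₂ x
    rw [hp]
    refine sumOut_mul_mul (D := D) ?_ ?_ ?_ ?_ ?_ ?_ ?_ h₁ h₂ x
    · rw [Finset.disjoint_left]
      intro v
      simp only [A, U, Finset.mem_filter, Finset.mem_univ, true_and]
      tauto
    · rw [Finset.disjoint_left]
      intro v
      simp only [A, D, Finset.mem_filter, Finset.mem_univ, true_and]
      tauto
    · rw [Finset.disjoint_left]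
      intro v
      simp only [U, D, Finset.mem_filter, Finset.mem_univ, true_and]
      tauto
    · intro v
      simp only [A, U, D, Finset.mem_filter, Finset.mem_univ, true_and]
      tauto
    · refine indepOf_prod_kernel hk fun v hv => ?_
      simp only [KA, Finset.mem_filter, Finset.mem_univ, true_and] at hv
      simp only [U, D, Finset.mem_union, Finset.mem_filter, Finset.mem_univ, true_and]
      refine ⟨by tauto, fun t ht => ?_⟩
      have : R t true := hv.elim (fun h => up_up h.2 h.1 ht) fun h => down_up h.2 h.1 ht
      tauto
    · refine indepOf_prod_kernel hk fun v hv => ?_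
      simp only [KU, Finset.mem_filter, Finset.mem_univ, true_and] at hv
      simp only [A, D, Finset.mem_union, Finset.mem_filter, Finset.mem_univ, true_and]
      refine ⟨by tauto, fun t ht h => ?_⟩
      have : R v false := h.elim (fun h => up_down h.2 h.1 ht) fun h => down_down h.2.2 h.1 ht
      tauto
    · exact sumOut_prod_kernel hE hk D
  have hBA : B ⊆ A := fun b hb => by
    simp only [A, Finset.mem_filter, Finset.mem_univ, true_and]
    exact ⟨Finset.disjoint_left.1 hBS hb, .start hb⟩
  have hsU : {s} ⊆ U := by
    simp only [U, Finset.singleton_subset_iff, Finset.mem_filter, Finset.mem_univ, true_and]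
    exact ⟨hsS, hs _, hs _⟩
  have k1 := key B {s} hBA hsU x
  have k2 := key ∅ ∅ (by simp) (by simp) x
  have k3 := key ∅ {s} (by simp) hsU x
  have k4 := key B ∅ hBA (by simp) x
  rw [show B ∪ {s} ∪ S = insert s (B ∪ S) by ext v; simp] at k1
  rw [show (∅ : Finset V) ∪ ∅ ∪ S = S by simp] at k2
  rw [show ∅ ∪ {s} ∪ S = insert s S by ext v; simp] at k3
  rw [show B ∪ ∅ ∪ S = B ∪ S by simp] at k4
  rw [k1, k2, k3, k4]
  ring

end Ball

section Markov

variable {V : Type*} [Fintype V] [DecidableEq V] {X : V → Type*} [∀ v, Fintype (X v)]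

/-- A pmf with the ordered local Markov property for a DAG factorizes over it. -/
theorem factorizes_of_localMarkov {E : V → V → Prop} (hE : IsDAG E) {p : (∀ v, X v) → ℝ}
    (hp : IsPMF X p) [∀ v, Nonempty (X v)] (P : V → Finset V) (hP : ∀ s t, t ∈ P s ↔ E t s)
    (h : ∀ (s : V) (C : Finset V), s ∉ C → P s ⊆ C → (∀ t ∈ C, ¬ Relation.TransGen E s t) →
      ∀ x, sumOut (insert s C)ᶜ p x * sumOut (P s)ᶜ p x =
        sumOut (insert s (P s))ᶜ p x * sumOut Cᶜ p x) :
    Factorizes X E p := by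
  classical
  have hsP : ∀ s, s ∉ P s := fun s hs => hE.irrefl s ((hP s s).1 hs)
  have nn : ∀ (C : Finset V) x, 0 ≤ sumOut C p x := fun C x => sumOut_nonneg hp.1 C x
  let k : ∀ s, X s → (∀ v, X v) → ℝ := fun s a x =>
    if sumOut (P s)ᶜ p x = 0 then (Fintype.card (X s) : ℝ)⁻¹
    else sumOut (insert s (P s))ᶜ p (Function.update x s a) / sumOut (P s)ᶜ p x
  have hk : ∀ s, IsKernel X E s (k s) := by
    refine fun s => ⟨fun a x => ?_, fun a x y hxy => ?_, fun x => ?_⟩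
    · simp only [k]
      split_ifs
      · positivity
      · exact div_nonneg (nn _ _) (nn _ _)
    · have h1 : sumOut (P s)ᶜ p x = sumOut (P s)ᶜ p y :=
        indepOf_sumOut_self _ p x y fun v hv => hxy v ((hP s v).1 (by simpa using hv))
      have h2 : sumOut (insert s (P s))ᶜ p (Function.update x s a) =
          sumOut (insert s (P s))ᶜ p (Function.update y s a) := by
        refine indepOf_sumOut_self _ p _ _ fun v hv => ?_
        by_cases hvs : v = s
        · subst hvs; simp
        · rw [Function.update_of_ne hvs, Function.update_of_ne hvs]
          exact hxy v ((hP s v).1 (by simpa [hvs] using hv))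
      simp only [k, h1, h2]
    · simp only [k]
      split_ifs with h0
      · simp
      · rw [← Finset.sum_div, ← sumOut_insert (by simp), Finset.insert_compl_insert (hsP s)]
        exact div_self h0
  refine ⟨k, hk, ?_⟩
  have main : ∀ n (C : Finset V), C.card = n → (∀ v ∈ C, ∀ t, E t v → t ∈ C) →
      ∀ x, sumOut Cᶜ p x = ∏ v ∈ C, k v (x v) x := by
    intro n
    induction n with
    | zero =>
      intro C hC _ x
      obtain rfl := Finset.card_eq_zero.1 hC
      simp [sumOut_univ, hp.2]
    | succ n ih =>
      intro C hC hanc x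
      obtain ⟨s, hsC, hs⟩ := hE.swap.exists_source (Finset.card_pos.1 (by omega : 0 < C.card))
      obtain ⟨C, hsC', rfl⟩ : ∃ D, s ∉ D ∧ C = insert s D :=
        ⟨C.erase s, by simp, (Finset.insert_erase hsC).symm⟩
      rw [Finset.card_insert_of_notMem hsC'] at hC
      have hanc' : ∀ v ∈ C, ∀ t, E t v → t ∈ C := fun v hv t ht =>
        (Finset.mem_insert.1 (hanc v (by simp [hv]) t ht)).resolve_left
          (by rintro rfl; exact hs v (by simp [hv]) ht)
      have hPC : P s ⊆ C := fun t ht => by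
        have ht' := (hP s t).1 ht
        exact (Finset.mem_insert.1 (hanc s (by simp) t ht')).resolve_left
          (by rintro rfl; exact hE.irrefl _ ht')
      have hdes : ∀ t ∈ C, ¬ Relation.TransGen E s t := by
        intro t ht hst
        induction hst with
        | single h => exact hs _ (by simp [ht]) h
        | tail _ h ih => exact ih (hanc' _ ht _ h)
      have hci := h s C hsC' hPC hdes x
      rw [Finset.prod_insert hsC', ← ih C (by omega) hanc']
      simp only [k, Function.update_eq_self]
      split_ifs with h0
      · have h1 : sumOut Cᶜ p x = 0 := le_antisymm
          (h0 ▸ sumOut_mono hp.1 (Finset.compl_subset_compl.2 hPC) x) (nn _ _)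
        have h2 : sumOut (insert s C)ᶜ p x = 0 := le_antisymm
          (h1 ▸ sumOut_mono hp.1 (Finset.compl_subset_compl.2 (Finset.subset_insert s C)) x)
          (nn _ _)
        rw [h1, h2, mul_zero]
      · rw [div_mul_eq_mul_div, eq_div_iff h0, hci]
  intro x
  rw [← main _ Finset.univ rfl (by simp) x, Finset.compl_univ, sumOut_empty]

end Markov

section Trails

variable {V : Type*} {E : V → V → Prop}

/-- `v` belongs to `S` or has a descendant in `S`. -/
def AncestralTo (E : V → V → Prop) (S : Set V) (v : V) : Prop :=
  ∃ t ∈ S, Relation.ReflTransGen E v t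

theorem AncestralTo.of_edge {S : Set V} {v w : V} (h : E v w) (hw : AncestralTo E S w) :
    AncestralTo E S v :=
  let ⟨t, ht, hwt⟩ := hw
  ⟨t, ht, hwt.head h⟩

/-- No interior node of `l` blocks `l`. -/
def InteriorActive (E : V → V → Prop) (S : Set V) (l : List V) : Prop :=
  ∀ a w b, [a, w, b] <:+: l →
    (E a w → E b w → AncestralTo E S w) ∧ (w ∈ S → E a w ∧ E b w)

theorem InteriorActive.infix {S : Set V} {l l' : List V} (h : InteriorActive E S l)
    (hl : l' <:+: l) : InteriorActive E S l' :=
  fun a w b ht => h a w b (ht.trans hl)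

theorem InteriorActive.cons {S : Set V} {w v : V} {l : List V}
    (h : InteriorActive E S (v :: l))
    (hv : ∀ y r, l = y :: r → (E w v → E y v → AncestralTo E S v) ∧ (v ∈ S → E w v ∧ E y v)) :
    InteriorActive E S (w :: v :: l) := by
  intro a u b ht
  rcases List.infix_cons_iff.1 ht with ht | ht
  · simp only [List.cons_prefix_cons] at ht
    obtain ⟨rfl, rfl, r, hr⟩ := ht
    exact hv b r hr.symm
  · exact h a u b ht

theorem vStruct_iff {l : List V} {u : V} :
    VStruct E l u ↔ ∃ a b, [a, u, b] <:+: l ∧ E a u ∧ E b u := by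
  constructor
  · rintro ⟨l₁, l₂, a, b, rfl, ha, hb⟩
    exact ⟨a, b, ⟨l₁, l₂, by simp⟩, ha, hb⟩
  · rintro ⟨a, b, ⟨l₁, l₂, rfl⟩, ha, hb⟩
    exact ⟨l₁, l₂, a, b, by simp, ha, hb⟩

theorem exists_infix_of_interior {l : List V} {s t u : V} (hu : u ∈ l)
    (hs : l.head? = some s) (ht : l.getLast? = some t) (hus : u ≠ s) (hut : u ≠ t) :
    ∃ a b, [a, u, b] <:+: l := by
  obtain ⟨l₁, l₂, rfl⟩ := List.append_of_mem hu
  rcases List.eq_nil_or_concat l₁ with rfl | ⟨l₁, a, rfl⟩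
  · simp at hs
    exact absurd hs hus
  · rcases l₂ with _ | ⟨b, l₂⟩
    · simp at ht
      exact absurd ht hut
    · exact ⟨a, b, l₁, l₂, by simp⟩

theorem List.Nodup.next_unique {l : List V} (hl : l.Nodup) {a b c : V} (hb : [a, b] <:+: l)
    (hc : [a, c] <:+: l) : b = c := by
  induction l with
  | nil => simp at hb
  | cons x l ih =>
    have hx := (List.nodup_cons.1 hl).1
    rcases List.infix_cons_iff.1 hb with hb | hb <;> rcases List.infix_cons_iff.1 hc with hc | hc
    · simp only [List.cons_prefix_cons] at hb hc
      obtain ⟨r, hr⟩ := hb.2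
      obtain ⟨r', hr'⟩ := hc.2
      simp only [List.cons_append] at hr hr'
      exact (List.cons.inj (hr.trans hr'.symm)).1
    · simp only [List.cons_prefix_cons] at hb
      exact absurd (hb.1 ▸ hc.subset (by simp)) hx
    · simp only [List.cons_prefix_cons] at hc
      exact absurd (hc.1 ▸ hb.subset (by simp)) hx
    · exact ih (List.nodup_cons.1 hl).2 hb hc

theorem List.Nodup.prev_unique {l : List V} (hl : l.Nodup) {a b c : V} (hb : [b, a] <:+: l)
    (hc : [c, a] <:+: l) : b = c :=
  (List.nodup_reverse.2 hl).next_unique (a := a) (List.reverse_infix.2 hb)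
    (List.reverse_infix.2 hc)

theorem List.Nodup.infix_glue {l : List V} (hl : l.Nodup) {a b c : V} (hab : [a, b] <:+: l)
    (hbc : [b, c] <:+: l) : [a, b, c] <:+: l := by
  obtain ⟨s, t, rfl⟩ := hbc
  rcases List.eq_nil_or_concat s with rfl | ⟨s, d, rfl⟩
  · exfalso
    simp only [List.nil_append, List.cons_append] at hab hl
    rcases List.infix_cons_iff.1 hab with h | h
    · simp only [List.cons_prefix_cons] at h
      obtain ⟨rfl, rfl, -⟩ := h
      simp at hl
    · exact (List.nodup_cons.1 hl).1 (h.subset (by simp))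
  · obtain rfl : d = a := hl.prev_unique (a := b) ⟨s, c :: t, by simp⟩ hab
    exact ⟨s, t, by simp⟩

theorem infix_left {l : List V} {a w b : V} (h : [a, w, b] <:+: l) : [a, w] <:+: l :=
  List.IsInfix.trans ⟨[], [b], rfl⟩ h

theorem infix_right {l : List V} {a w b : V} (h : [a, w, b] <:+: l) : [w, b] <:+: l :=
  List.IsInfix.trans ⟨[a], [], rfl⟩ h

theorem List.Nodup.ne_head_of_infix {l : List V} (hl : l.Nodup) {s a w : V}
    (hs : l.head? = some s) (h : [a, w] <:+: l) : w ≠ s := by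
  rintro rfl
  obtain ⟨l, rfl⟩ : ∃ l', l = w :: l' := by
    cases l with
    | nil => simp at hs
    | cons x l => exact ⟨l, by simpa using hs⟩
  rcases List.infix_cons_iff.1 h with h | h
  · simp only [List.cons_prefix_cons] at h
    obtain ⟨rfl, r, rfl⟩ := h
    simp at hl
  · exact (List.nodup_cons.1 hl).1 (h.subset (by simp))

theorem List.Nodup.ne_getLast_of_infix {l : List V} (hl : l.Nodup) {t w b : V}
    (ht : l.getLast? = some t) (h : [w, b] <:+: l) : w ≠ t :=
  (List.nodup_reverse.2 hl).ne_head_of_infix (a := b) (by simpa using ht)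
    (List.reverse_infix.2 h)

theorem not_blockedBy_iff {S : Set V} {l : List V} {s t : V} (hl : IsTrail E l)
    (hs : l.head? = some s) (ht : l.getLast? = some t) :
    ¬ BlockedBy E S l ↔ s ∉ S ∧ t ∉ S ∧ InteriorActive E S l := by
  have hnd := hl.2.1
  constructor
  · intro h
    have hS : ∀ u ∈ l, u ∈ S → ∃ a b, [a, u, b] <:+: l ∧ E a u ∧ E b u := by
      intro u hu huS
      by_contra hcon
      exact h ⟨u, hu, Or.inl ⟨huS, fun hv => hcon (vStruct_iff.1 hv)⟩⟩
    refine ⟨fun hsS => ?_, fun htS => ?_, fun a w b hw => ⟨fun ha hb => ?_, fun hwS => ?_⟩⟩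
    · obtain ⟨a, b, hab, -⟩ := hS s (List.mem_of_head? hs) hsS
      exact hnd.ne_head_of_infix hs (infix_left hab) rfl
    · obtain ⟨a, b, hab, -⟩ := hS t (List.mem_of_getLast? ht) htS
      exact hnd.ne_getLast_of_infix ht (infix_right hab) rfl
    · by_contra hcon
      refine h ⟨w, hw.subset (by simp), Or.inr ⟨vStruct_iff.2 ⟨a, b, hw, ha, hb⟩, fun hwS => ?_,
        fun t ht htS => ?_⟩⟩
      · exact hcon ⟨w, hwS, .refl⟩
      · exact hcon ⟨t, htS, Relation.TransGen.to_reflTransGen ht⟩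
    · obtain ⟨a', b', hab, ha, hb⟩ := hS w (hw.subset (by simp)) hwS
      rw [hnd.prev_unique (infix_left hw) (infix_left hab),
        hnd.next_unique (infix_right hw) (infix_right hab)]
      exact ⟨ha, hb⟩
  · rintro ⟨hsS, htS, hact⟩ ⟨u, hu, ⟨huS, hv⟩ | ⟨hv, huS, hdes⟩⟩
    · obtain ⟨a, b, hab⟩ := exists_infix_of_interior hu hs ht (by rintro rfl; exact hsS huS)
        (by rintro rfl; exact htS huS)
      exact hv (vStruct_iff.2 ⟨a, b, hab, (hact a u b hab).2 huS⟩)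
    · obtain ⟨a, b, hab, ha, hb⟩ := vStruct_iff.1 hv
      obtain ⟨t, htS, hut⟩ := (hact a u b hab).1 ha hb
      rcases Relation.reflTransGen_iff_eq_or_transGen.1 hut with rfl | hut
      · exact huS htS
      · exact hdes t hut htS

theorem ancestralTo_of_suffix {S : Set V} {v w b : V} {l₁ l₂ l : List V}
    (hl : v :: l = l₁ ++ b :: w :: l₂) (hact : InteriorActive E S (v :: l))
    (hch : (v :: l).IsChain (GJoined E))
    (hv : ∀ y r, l = y :: r → E y v → AncestralTo E S v) (hwb : E w b) :
    AncestralTo E S b := by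
  induction l₁ using List.reverseRecOn generalizing b w l₂ with
  | nil =>
    obtain ⟨rfl, rfl⟩ : v = b ∧ l = w :: l₂ := by simpa using hl
    exact hv w l₂ rfl hwb
  | append_singleton l₀ a ih =>
    have hl' : v :: l = l₀ ++ a :: b :: w :: l₂ := by simpa using hl
    have htr : [a, b, w] <:+: v :: l := ⟨l₀, l₂, by simp [hl']⟩
    rw [hl', List.isChain_append] at hch
    have hab : GJoined E a b := by
      have := hch.2.1
      simp only [List.isChain_cons_cons] at this
      exact this.1
    rcases hab with hab | hba
    · exact (hact a b w htr).1 hab hwb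
    · exact .of_edge hba (ih hl' hba)

/-- An active trail, written from its current end `v` back to a starting node in `B`. -/
structure BallTrail (E : V → V → Prop) (S B : Set V) (v : V) (l : List V) : Prop where
  nodup : (v :: l).Nodup
  chain : (v :: l).IsChain (GJoined E)
  active : InteriorActive E S (v :: l)
  last : ∃ b ∈ B, (v :: l).getLast? = some b

theorem BallTrail.suffix {S B : Set V} {v w : V} {l l₁ l₂ : List V} (h : BallTrail E S B v l)
    (hl : v :: l = l₁ ++ w :: l₂) : BallTrail E S B w l₂ := by
  have hs : w :: l₂ <:+ v :: l := ⟨l₁, hl.symm⟩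
  refine ⟨h.nodup.sublist hs.sublist, h.chain.suffix hs, h.active.infix hs.isInfix, ?_⟩
  obtain ⟨b, hb, hlast⟩ := h.last
  refine ⟨b, hb, ?_⟩
  rw [hl] at hlast
  simpa using hlast

theorem BallTrail.exists_up {S B : Set V} (hE : IsDAG E) {v w : V} {l : List V}
    (h : BallTrail E S B v l) (hwv : E w v)
    (hv : ∀ y r, l = y :: r → E y v → AncestralTo E S v)
    (hS : v ∈ S → ∃ y r, l = y :: r ∧ E y v) :
    ∃ l', BallTrail E S B w l' ∧ ∀ y r, l' = y :: r → E y w → AncestralTo E S w := by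
  by_cases hw : w ∈ v :: l
  · obtain ⟨l₁, l₂, hl⟩ := List.append_of_mem hw
    refine ⟨l₂, h.suffix hl, ?_⟩
    rintro y r rfl hyw
    rcases List.eq_nil_or_concat l₁ with rfl | ⟨l₁, b, rfl⟩
    · obtain ⟨rfl, -⟩ : v = w ∧ l = y :: r := by simpa using hl
      exact absurd hwv (hE.irrefl _)
    · have hl' : v :: l = l₁ ++ b :: w :: y :: r := by simpa using hl
      have htr : [b, w, y] <:+: v :: l := ⟨l₁, r, by simp [hl']⟩
      have hch := h.chain
      rw [hl', List.isChain_append] at hch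
      have hbw : GJoined E b w := by
        have := hch.2.1
        simp only [List.isChain_cons_cons] at this
        exact this.1
      rcases hbw with hbw | hwb
      · exact (h.active b w y htr).1 hbw hyw
      · exact .of_edge hwb (ancestralTo_of_suffix hl' h.active h.chain hv hwb)
  · refine ⟨v :: l, ⟨List.nodup_cons.2 ⟨hw, h.nodup⟩, ?_, h.active.cons ?_, ?_⟩, ?_⟩
    · exact List.isChain_cons_cons.2 ⟨Or.inl hwv, h.chain⟩
    · rintro y r rfl
      refine ⟨fun _ hyv => hv y r rfl hyv, fun hvS => ⟨hwv, ?_⟩⟩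
      obtain ⟨y', r', h', hy'⟩ := hS hvS
      obtain ⟨rfl, rfl⟩ := List.cons.inj h'
      exact hy'
    · simpa using h.last
    · rintro y r hl hyw
      obtain ⟨rfl, -⟩ := List.cons.inj hl
      exact absurd hyw (hE.asymm hwv)

theorem BallTrail.exists_down {S B : Set V} (hE : IsDAG E) (hBS : ∀ b ∈ B, b ∉ S) {v w : V}
    {l : List V} (h : BallTrail E S B v l) (hvw : E v w) (hS : v ∉ S) :
    ∃ l', BallTrail E S B w l' ∧ (w ∈ S → ∃ y r, l' = y :: r ∧ E y w) := by
  by_cases hw : w ∈ v :: l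
  · obtain ⟨l₁, l₂, hl⟩ := List.append_of_mem hw
    have h' := h.suffix hl
    refine ⟨l₂, h', fun hwS => ?_⟩
    rcases l₂ with _ | ⟨y, r⟩
    · obtain ⟨b, hb, hwb⟩ := h'.last
      obtain rfl : w = b := by simpa using hwb
      exact absurd hwS (hBS _ hb)
    · refine ⟨y, r, rfl, ?_⟩
      rcases List.eq_nil_or_concat l₁ with rfl | ⟨l₁, b, rfl⟩
      · obtain ⟨rfl, -⟩ : v = w ∧ l = y :: r := by simpa using hl
        exact absurd hvw (hE.irrefl _)
      · exact ((h.active b w y ⟨l₁, r, by simp [hl]⟩).2 hwS).2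
  · refine ⟨v :: l, ⟨List.nodup_cons.2 ⟨hw, h.nodup⟩, ?_, h.active.cons ?_, ?_⟩, ?_⟩
    · exact List.isChain_cons_cons.2 ⟨Or.inr hvw, h.chain⟩
    · rintro y r rfl
      exact ⟨fun hwv => absurd hwv (hE.asymm hvw), fun hvS => absurd hvS hS⟩
    · simpa using h.last
    · exact fun _ => ⟨v, l, rfl, hvw⟩

theorem BallReach.exists_ballTrail {S B : Set V} (hE : IsDAG E) (hBS : ∀ b ∈ B, b ∉ S) {v : V}
    {d : Bool} (h : BallReach E S B v d) :
    ∃ l, BallTrail E S B v l ∧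
      (d = true → ∀ y r, l = y :: r → E y v → AncestralTo E S v) ∧
      (d = false → v ∈ S → ∃ y r, l = y :: r ∧ E y v) := by
  induction h with
  | @start b hb =>
    refine ⟨[], ⟨by simp, by simp, ?_, b, hb, rfl⟩, by simp, by simp⟩
    intro x y z h
    simpa using h.length_le
  | up_up _ hS hw ih =>
    obtain ⟨l, hl, h1, -⟩ := ih
    obtain ⟨l', hl', h'⟩ := hl.exists_up hE hw (h1 rfl) fun h => absurd h hS
    exact ⟨l', hl', fun _ => h', by simp⟩
  | up_down _ hS hw ih =>
    obtain ⟨l, hl, -⟩ := ih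
    obtain ⟨l', hl', h'⟩ := hl.exists_down hE hBS hw hS
    exact ⟨l', hl', by simp, fun _ => h'⟩
  | down_down _ hS hw ih =>
    obtain ⟨l, hl, -⟩ := ih
    obtain ⟨l', hl', h'⟩ := hl.exists_down hE hBS hw hS
    exact ⟨l', hl', by simp, fun _ => h'⟩
  | down_up _ hS hw ih =>
    obtain ⟨l, hl, -, h2⟩ := ih
    obtain ⟨l', hl', h'⟩ := hl.exists_up hE hw (fun _ _ _ _ => ⟨_, hS, .refl⟩) (h2 rfl)
    exact ⟨l', hl', fun _ => h', by simp⟩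

theorem DSep.not_ballReach {A B S : Set V} (hE : IsDAG E) (h : DSep E A B S) {s : V}
    (hsA : s ∈ A) (hsS : s ∉ S) (d : Bool) : ¬ BallReach E S (B \ S) s d := by
  intro hr
  obtain ⟨l, hl, -⟩ := hr.exists_ballTrail hE fun b hb => hb.2
  obtain ⟨b, hb, hlast⟩ := hl.last
  have ht : IsTrail E (s :: l) := ⟨by simp, hl.nodup, hl.chain⟩
  exact (not_blockedBy_iff ht rfl hlast).2 ⟨hsS, hb.2, hl.active⟩
    (h (s :: l) s b ht rfl hlast hsA hb.1)

end Trails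

theorem factorizes_of_dSep {V : Type*} [Fintype V] [DecidableEq V] {X : V → Type*}
    [∀ v, Fintype (X v)] [∀ v, Nonempty (X v)] {E E' : V → V → Prop} (hE : IsDAG E)
    (hE' : IsDAG E') (h : ∀ s : V, DSep E {s} ({t | t ≠ s} \ desG E' s) (paG E' s))
    {p : (∀ v, X v) → ℝ} (hp : IsPMF X p) (hpE : Factorizes X E p) : Factorizes X E' p := by
  classical
  obtain ⟨k, hk, hpk⟩ := hpE
  obtain rfl : p = fun y => ∏ v, k v (y v) y := funext hpk
  have hP : ∀ s t, t ∈ univ.filter (E' · s) ↔ E' t s := by simp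
  refine factorizes_of_localMarkov hE' hp _ hP fun s C hsC hPC hC x => ?_
  have hsP : s ∉ univ.filter (E' · s) := fun hs => hE'.irrefl s ((hP s s).1 hs)
  have hB : C \ univ.filter (E' · s) ∪ univ.filter (E' · s) = C := sdiff_union_of_subset hPC
  have hreach : ∀ d, ¬ BallReach E (↑(univ.filter (E' · s)) : Set V)
      (↑(C \ univ.filter (E' · s)) : Set V) s d := by
    intro d
    have hS : (↑(univ.filter (E' · s)) : Set V) = paG E' s := by ext t; simp [paG]
    have hsep : DSep E {s} (↑C) (↑(univ.filter (E' · s))) := by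
      rw [hS]
      exact fun l a b hl ha hb has hbC => h s l a b hl ha hb has
        ⟨fun hbs => hsC (hbs ▸ hbC), hC b hbC⟩
    have := hsep.not_ballReach hE (Set.mem_singleton s) (by simpa using hE'.irrefl s) d
    rwa [coe_sdiff]
  have := sumOut_mul_eq_of_not_ballReach hE hk sdiff_disjoint hsP hreach x
  rwa [hB] at this

section Reroute

variable {V : Type*} {E : V → V → Prop} {S : Set V}

theorem List.infix_triple_append_cons {A B : List V} {a w b x : V}
    (h : [a, w, b] <:+: A ++ x :: B) :
    [a, w, b] <:+: A ++ [x] ∨ [a, w, b] <:+: x :: B ∨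
      (w = x ∧ A.getLast? = some a ∧ B.head? = some b) := by
  induction A with
  | nil => exact Or.inr (Or.inl h)
  | cons y A ih =>
    rcases List.infix_cons_iff.1 h with ⟨r, hr⟩ | h
    · rcases A with _ | ⟨z, _ | ⟨z', A⟩⟩
      · simp only [List.nil_append, List.cons_append, List.cons.injEq] at hr
        obtain ⟨rfl, rfl, rfl⟩ := hr
        exact Or.inr (Or.inr ⟨rfl, rfl, rfl⟩)
      · simp only [List.nil_append, List.cons_append, List.cons.injEq] at hr
        obtain ⟨rfl, rfl, rfl, -⟩ := hr
        exact Or.inl (List.infix_refl _)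
      · simp only [List.nil_append, List.cons_append, List.cons.injEq] at hr
        obtain ⟨rfl, rfl, rfl, -⟩ := hr
        exact Or.inl ⟨[], A ++ [x], by simp⟩
    · rcases ih h with h | h | ⟨h1, h2, h3⟩
      · exact Or.inl (h.trans (List.suffix_cons _ _).isInfix)
      · exact Or.inr (Or.inl h)
      · refine Or.inr (Or.inr ⟨h1, ?_, h3⟩)
        rw [List.getLast?_cons, h2]
        rfl

/-- `l` is a trail from `s` to `t` all of whose interior nodes are active given `S`. -/
structure ActiveTrail (E : V → V → Prop) (S : Set V) (s t : V) (l : List V) : Prop where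
  trail : IsTrail E l
  head : l.head? = some s
  last : l.getLast? = some t
  active : InteriorActive E S l

theorem vStruct_reverse {l : List V} {u : V} : VStruct E l.reverse u ↔ VStruct E l u := by
  simp only [vStruct_iff]
  constructor
  · rintro ⟨a, b, h, ha, hb⟩
    exact ⟨b, a, by simpa using List.reverse_infix.2 h, hb, ha⟩
  · rintro ⟨a, b, h, ha, hb⟩
    exact ⟨b, a, List.reverse_infix.1 (by simpa using h), hb, ha⟩

theorem ActiveTrail.reverse {s t : V} {l : List V} (h : ActiveTrail E S s t l) :
    ActiveTrail E S t s l.reverse := by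
  refine ⟨⟨by simpa using h.trail.1, List.nodup_reverse.2 h.trail.2.1, ?_⟩,
    by simpa using h.last, by simpa using h.head, fun a w b hw => ?_⟩
  · exact List.isChain_reverse.2 (h.trail.2.2.imp fun _ _ => Or.symm)
  · have := h.active b w a (by simpa using List.reverse_infix.2 hw)
    exact ⟨fun ha hb => this.1 hb ha, fun hS => (this.2 hS).symm⟩

theorem IsDAG.nodup_of_isChain (hE : IsDAG E) {l : List V} (hl : l.IsChain E) : l.Nodup := by
  have : l.Pairwise (Relation.TransGen E) :=
    List.isChain_iff_pairwise.1 (hl.imp fun _ _ => .single)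
  refine this.imp ?_
  rintro a _ hab rfl
  exact hE a hab

/-- Replace the part of an active trail between a collider `c` and a later node `u` by a directed
path from `c` to `u`. -/
theorem ActiveTrail.reroute (hE : IsDAG E) {s t c u : V} {l₁ m₀ m l₂ : List V}
    (h : ActiveTrail E S s t (l₁ ++ c :: (m₀ ++ u :: l₂))) (hcS : c ∉ S)
    (hm : (c :: (m ++ [u])).IsChain E)
    (hml : ∀ v ∈ m, v ∉ l₁ ++ c :: (m₀ ++ u :: l₂)) (hmS : ∀ v ∈ m, v ∉ S)
    (hu : AncestralTo E S u) :
    ActiveTrail E S s t (l₁ ++ c :: (m ++ u :: l₂)) ∧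
      ∀ w, VStruct E (l₁ ++ c :: (m ++ u :: l₂)) w →
        w = u ∨ (w ≠ c ∧ VStruct E (l₁ ++ c :: (m₀ ++ u :: l₂)) w) := by
  have hi₁ : l₁ ++ [c] <:+: l₁ ++ c :: (m₀ ++ u :: l₂) := ⟨[], m₀ ++ u :: l₂, by simp⟩
  have hi₂ : u :: l₂ <:+: l₁ ++ c :: (m₀ ++ u :: l₂) := ⟨l₁ ++ c :: m₀, [], by simp⟩
  have hnd := h.trail.2.1
  have hndm := hE.nodup_of_isChain hm
  have hnd₁ : (l₁ ++ [c]).Nodup := hnd.sublist hi₁.sublist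
  have hcu : c ∉ u :: l₂ := by
    intro hc
    exact (List.nodup_cons.1 (List.nodup_append.1 hnd).2.1).1 (List.mem_append_right _ hc)
  have hmid : ∀ a w b, [a, w, b] <:+: c :: (m ++ [u]) → w ∈ m ∧ E a w ∧ E w b := by
    intro a w b hw
    have h1 := hndm.ne_head_of_infix (s := c) rfl (infix_left hw)
    have h2 := hndm.ne_getLast_of_infix (t := u) (by simp [List.getLast?_cons]) (infix_right hw)
    have h3 : w ∈ c :: (m ++ [u]) := hw.subset (by simp)
    have h4 := hm.infix hw
    simp only [List.isChain_cons_cons] at h4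
    refine ⟨?_, h4.1, h4.2.1⟩
    simpa [h1, h2] using h3
  have hsplit : ∀ a w b, [a, w, b] <:+: l₁ ++ c :: (m ++ u :: l₂) →
      ([a, w, b] <:+: l₁ ++ [c]) ∨ ((w = c ∨ w ∈ m) ∧ E w b) ∨
      (w = u ∧ E a u ∧ ∃ a', [a', u, b] <:+: l₁ ++ c :: (m₀ ++ u :: l₂)) ∨
      [a, w, b] <:+: u :: l₂ := by
    intro a w b hw
    rcases List.infix_triple_append_cons hw with hw | hw | ⟨rfl, ha, hb⟩
    · exact Or.inl hw
    · rw [← List.cons_append] at hw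
      rcases List.infix_triple_append_cons hw with hw | hw | ⟨rfl, ha, hb⟩
      · obtain ⟨h1, -, h3⟩ := hmid a w b hw
        exact Or.inr (Or.inl ⟨Or.inr h1, h3⟩)
      · exact Or.inr (Or.inr (Or.inr hw))
      · refine Or.inr (Or.inr (Or.inl ⟨rfl, ?_, ?_⟩))
        · obtain ⟨r, hr⟩ := List.getLast?_eq_some_iff.1 ha
          rw [← List.cons_append, hr] at hm
          have := hm.infix (l₁ := [a, w]) ⟨r, [], by simp⟩
          simpa using this
        · obtain ⟨r, rfl⟩ := List.head?_eq_some_iff.1 hb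
          rcases List.eq_nil_or_concat (c :: m₀) with h0 | ⟨r', a', h0⟩
          · simp at h0
          · refine ⟨a', l₁ ++ r', r, ?_⟩
            rw [← List.cons_append, h0]
            simp
    · refine Or.inr (Or.inl ⟨Or.inl rfl, ?_⟩)
      rcases m with _ | ⟨y, m⟩ <;> simp_all
  refine ⟨⟨⟨by simp, ?_, ?_⟩, ?_, ?_, ?_⟩, ?_⟩
  · have hperm : (l₁ ++ c :: (m ++ u :: l₂)).Perm (m ++ (l₁ ++ c :: u :: l₂)) :=
      (List.perm_middle.symm.append_left l₁).trans (List.perm_append_comm_assoc _ _ _)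
    have hsub : (l₁ ++ c :: u :: l₂).Sublist (l₁ ++ c :: (m₀ ++ u :: l₂)) :=
      ((List.sublist_append_right m₀ _).cons_cons c).append_left l₁
    refine hperm.nodup_iff.2 (List.nodup_append.2 ⟨?_, hnd.sublist hsub, ?_⟩)
    · exact (List.nodup_append.1 (List.nodup_cons.1 hndm).2).1
    · rintro v hv _ hv' rfl
      exact hml v hv (hsub.subset hv')
  · refine List.isChain_split.2 ⟨h.trail.2.2.infix hi₁, ?_⟩
    rw [← List.cons_append]
    refine List.isChain_split.2 ⟨hm.imp fun _ _ => Or.inl, h.trail.2.2.infix hi₂⟩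
  · have := h.head
    cases l₁ <;> simpa using this
  · have := h.last
    simpa [List.getLast?_append, List.getLast?_cons] using this
  · intro a w b hw
    rcases hsplit a w b hw with hw | ⟨h1, h2⟩ | ⟨rfl, ha, a', ha'⟩ | hw
    · exact h.active.infix hi₁ a w b hw
    · refine ⟨fun _ hb => absurd hb (hE.asymm h2), fun hwS => ?_⟩
      rcases h1 with rfl | h1
      · exact absurd hwS hcS
      · exact absurd hwS (hmS _ h1)
    · exact ⟨fun _ _ => hu, fun hS => ⟨ha, ((h.active _ _ _ ha').2 hS).2⟩⟩
    · exact h.active.infix hi₂ a w b hw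
  · intro w hw
    obtain ⟨a, b, htr, ha, hb⟩ := vStruct_iff.1 hw
    rcases hsplit a w b htr with hi | ⟨-, h2⟩ | ⟨rfl, -⟩ | hi
    · exact Or.inr ⟨hnd₁.ne_getLast_of_infix (t := c) (by simp) (infix_right hi),
        vStruct_iff.2 ⟨a, b, hi.trans hi₁, ha, hb⟩⟩
    · exact absurd hb (hE.asymm h2)
    · exact Or.inl rfl
    · refine Or.inr ⟨?_, vStruct_iff.2 ⟨a, b, hi.trans hi₂, ha, hb⟩⟩
      rintro rfl
      exact hcu (hi.subset (by simp))

theorem ActiveTrail.ancestralTo_of_vStruct {s t c : V} {l : List V} (h : ActiveTrail E S s t l)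
    (hc : VStruct E l c) : AncestralTo E S c := by
  obtain ⟨a, b, hw, ha, hb⟩ := vStruct_iff.1 hc
  exact (h.active a c b hw).1 ha hb

theorem exists_next_ancestralTo (E : V → V → Prop) (S : Set V) :
    ∃ nxt : V → V, ∀ v, AncestralTo E S v → v ∉ S → E v (nxt v) ∧ AncestralTo E S (nxt v) := by
  have : ∀ v, ∃ w, AncestralTo E S v → v ∉ S → E v w ∧ AncestralTo E S w := by
    intro v
    by_cases h : AncestralTo E S v ∧ v ∉ S
    · obtain ⟨⟨t, htS, hvt⟩, hvS⟩ := h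
      rcases Relation.ReflTransGen.cases_head hvt with rfl | ⟨w, hvw, hwt⟩
      · exact absurd htS hvS
      · exact ⟨w, fun _ _ => ⟨hvw, t, htS, hwt⟩⟩
    · exact ⟨v, fun h1 h2 => absurd ⟨h1, h2⟩ h⟩
  choose nxt hnxt using this
  exact ⟨nxt, hnxt⟩

variable [Fintype V]

open Classical in
/-- The number of colliders of `l`, each weighted by its number of descendants. -/
noncomputable def colliderCost (E : V → V → Prop) (l : List V) : ℕ :=
  ∑ w with VStruct E l w, (1 + #{v | Relation.TransGen E w v})

theorem IsDAG.card_descendants_lt (hE : IsDAG E) [DecidableRel (Relation.TransGen E)] {c u : V}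
    (h : Relation.TransGen E c u) :
    #{v | Relation.TransGen E u v} < #{v | Relation.TransGen E c v} := by
  refine card_lt_card ((ssubset_iff_of_subset fun v hv => ?_).2 ⟨u, by simpa using h, ?_⟩)
  · simp only [mem_filter_univ] at hv ⊢
    exact h.trans hv
  · simpa using hE u

theorem colliderCost_lt (hE : IsDAG E) {l l' : List V} {c u : V} (hc : VStruct E l c)
    (hcu : Relation.TransGen E c u) (h : ∀ w, VStruct E l' w → w = u ∨ (w ≠ c ∧ VStruct E l w)) :
    colliderCost E l' < colliderCost E l := by
  classical
  unfold colliderCost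
  rw [← add_sum_erase _ _ (show c ∈ univ.filter (VStruct E l ·) by simpa using hc)]
  calc _ ≤ ∑ w ∈ insert u ((univ.filter (VStruct E l ·)).erase c),
        (1 + #{v | Relation.TransGen E w v}) :=
        sum_le_sum_of_subset fun w hw => by simpa using h w (by simpa using hw)
    _ ≤ (1 + #{v | Relation.TransGen E u v}) +
        ∑ w ∈ (univ.filter (VStruct E l ·)).erase c, (1 + #{v | Relation.TransGen E w v}) := by
        rw [insert_eq]
        exact (Nat.le_add_right _ _).trans (sum_union_inter ..).le |>.trans (by simp)
    _ < _ := by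
        have := hE.card_descendants_lt hcu
        gcongr

theorem ActiveTrail.exists_colliderCost_lt (hE : IsDAG E) {s t c u : V} {l m : List V}
    (h : ActiveTrail E S s t l) (hc : VStruct E l c) (hcS : c ∉ S)
    (hm : (c :: (m ++ [u])).IsChain E) (hml : ∀ v ∈ m, v ∉ l) (hmS : ∀ v ∈ m, v ∉ S)
    (hu : AncestralTo E S u) (hul : u ∈ l) :
    ∃ l', ActiveTrail E S s t l' ∧ colliderCost E l' < colliderCost E l := by
  have hcu : Relation.TransGen E c u := by
    have := List.isChain_iff_pairwise.1 (hm.imp fun _ _ => Relation.TransGen.single)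
    exact (List.pairwise_cons.1 this).1 u (by simp)
  have hne : u ≠ c := by
    rintro rfl
    exact hE u hcu
  have hcl : c ∈ l := by
    obtain ⟨a, b, hw, -⟩ := vStruct_iff.1 hc
    exact hw.subset (by simp)
  obtain ⟨l₁, l₂, rfl⟩ := List.append_of_mem hcl
  have hul' : u ∈ l₁ ∨ u ∈ l₂ := by simpa [hne] using hul
  rcases hul' with hul' | hul'
  · obtain ⟨l₀, m₀, rfl⟩ := List.append_of_mem hul'
    have hr := h.reverse
    have hrev : (l₀ ++ u :: m₀ ++ c :: l₂).reverse =
        l₂.reverse ++ c :: (m₀.reverse ++ u :: l₀.reverse) := by simp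
    obtain ⟨h1, h2⟩ := (hrev ▸ hr).reroute hE hcS hm
      (fun v hv hvl => hml v hv (List.mem_reverse.1 (hrev ▸ hvl))) hmS hu
    refine ⟨_, h1.reverse, colliderCost_lt hE hc hcu fun w hw => ?_⟩
    have := h2 w (vStruct_reverse.1 hw)
    rwa [← hrev, vStruct_reverse] at this
  · obtain ⟨m₀, l₃, rfl⟩ := List.append_of_mem hul'
    obtain ⟨h1, h2⟩ := h.reroute hE hcS hm hml hmS hu
    exact ⟨_, h1, colliderCost_lt hE hc hcu h2⟩

theorem ActiveTrail.exists_minimal {s t : V} {l : List V} (h : ActiveTrail E S s t l) :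
    ∃ l', ActiveTrail E S s t l' ∧
      ∀ l'', ActiveTrail E S s t l'' → colliderCost E l' ≤ colliderCost E l'' := by
  classical
  have hex : ∃ n l, ActiveTrail E S s t l ∧ colliderCost E l = n := ⟨_, l, h, rfl⟩
  obtain ⟨l', hl', hn⟩ := Nat.find_spec hex
  exact ⟨l', hl', fun l'' h'' => hn ▸ Nat.find_min' hex ⟨l'', h'', rfl⟩⟩

/-- The nodes met when following `nxt` from the colliders of `l` outside `S` until `S` is hit. -/
inductive Downstream (E : V → V → Prop) (S : Set V) (l : List V) (nxt : V → V) : V → Prop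
  | start {c : V} (hc : VStruct E l c) (hcS : c ∉ S) : Downstream E S l nxt (nxt c)
  | step {v : V} (hv : Downstream E S l nxt v) (hvS : v ∉ S) : Downstream E S l nxt (nxt v)

theorem Downstream.spec (hE : IsDAG E) {s t v : V} {l : List V} (h : ActiveTrail E S s t l)
    (hmin : ∀ l', ActiveTrail E S s t l' → colliderCost E l ≤ colliderCost E l') {nxt : V → V}
    (hnxt : ∀ v, AncestralTo E S v → v ∉ S → E v (nxt v) ∧ AncestralTo E S (nxt v))
    (hv : Downstream E S l nxt v) : AncestralTo E S v ∧ v ∉ l := by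
  suffices AncestralTo E S v ∧ v ∉ l ∧ ∃ c m, VStruct E l c ∧ c ∉ S ∧
      (c :: (m ++ [v])).IsChain E ∧ (∀ w ∈ m, w ∉ l) ∧ ∀ w ∈ m, w ∉ S from ⟨this.1, this.2.1⟩
  have hout : ∀ c m u, VStruct E l c → c ∉ S → (c :: (m ++ [u])).IsChain E → (∀ w ∈ m, w ∉ l) →
      (∀ w ∈ m, w ∉ S) → AncestralTo E S u → u ∉ l := by
    intro c m u hc hcS hm hml hmS hu hul
    obtain ⟨l', hl', hlt⟩ := h.exists_colliderCost_lt hE hc hcS hm hml hmS hu hul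
    exact (hmin l' hl').not_gt hlt
  induction hv with
  | @start c hc hcS =>
    obtain ⟨h1, h2⟩ := hnxt c (h.ancestralTo_of_vStruct hc) hcS
    have hch : (c :: ([] ++ [nxt c])).IsChain E := by simpa using h1
    exact ⟨h2, hout c [] _ hc hcS hch (by simp) (by simp) h2, c, [], hc, hcS, hch, by simp,
      by simp⟩
  | @step v _ hvS ih =>
    obtain ⟨hv, hvl, c, m, hc, hcS, hch, hml, hmS⟩ := ih
    obtain ⟨h1, h2⟩ := hnxt v hv hvS
    have hch' : (c :: ((m ++ [v]) ++ [nxt v])).IsChain E := by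
      rw [List.append_assoc, ← List.cons_append]
      exact List.isChain_split.2 ⟨hch, by simpa using h1⟩
    have hml' : ∀ w ∈ m ++ [v], w ∉ l := by
      simpa [or_imp, forall_and] using ⟨hml, hvl⟩
    have hmS' : ∀ w ∈ m ++ [v], w ∉ S := by
      simpa [or_imp, forall_and] using ⟨hmS, hvS⟩
    exact ⟨h2, hout c _ _ hc hcS hch' hml' hmS' h2, c, _, hc, hcS, hch', hml', hmS'⟩

end Reroute

section ParityModel

variable {V : Type*} {E : V → V → Prop} {S : Set V} {l : List V}

/-- `a` and `b` are consecutive in `l`, in one order or the other. -/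
def ListAdj (l : List V) (a b : V) : Prop := [a, b] <:+: l ∨ [b, a] <:+: l

theorem not_vStruct_of_listAdj (hE : IsDAG E) (hl : l.Nodup) {a b : V} (h : ListAdj l a b)
    (hab : E a b) : ¬ VStruct E l a := by
  intro ha
  obtain ⟨c, d, hw, hc, hd⟩ := vStruct_iff.1 ha
  rcases h with h | h
  · rw [hl.next_unique (infix_right hw) h] at hd
    exact hE.asymm hab hd
  · rw [hl.prev_unique (infix_left hw) h] at hc
    exact hE.asymm hab hc

theorem listAdj_unique (hl : l.Nodup) {a p v : V} (ha : ListAdj l a v) (hp : ListAdj l p v)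
    (hav : E a v) (hpv : E p v) (hv : ¬ VStruct E l v) : p = a := by
  rcases ha with ha | ha <;> rcases hp with hp | hp
  · exact hl.prev_unique hp ha
  · exact absurd (vStruct_iff.2 ⟨a, p, hl.infix_glue ha hp, hav, hpv⟩) hv
  · exact absurd (vStruct_iff.2 ⟨p, a, hl.infix_glue hp ha, hpv, hav⟩) hv
  · exact hl.next_unique hp ha

theorem listAdj_of_infix (hl : l.Nodup) {a p v b : V} (h : [a, v, b] <:+: l) :
    ListAdj l p v ↔ p = a ∨ p = b := by
  constructor
  · rintro (hp | hp)
    · exact Or.inl (hl.prev_unique hp (infix_left h))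
    · exact Or.inr (hl.next_unique hp (infix_right h))
  · rintro (rfl | rfl)
    · exact Or.inl (infix_left h)
    · exact Or.inr (infix_right h)

theorem add_getLast_eq_sum_colliders (hE : IsDAG E) [DecidablePred (VStruct E l)]
    (hl : l.Nodup) (hch : l.IsChain (GJoined E)) (g : V → ZMod 2)
    (h1 : ∀ a b, ListAdj l a b → E a b → ¬ VStruct E l b → g b = g a)
    (h2 : ∀ a w b, [a, w, b] <:+: l → E a w → E b w → g w = g a + g b) {t : V}
    (ht : l.getLast? = some t) {pre r : List V} {y z : V} (hsplit : l = pre ++ y :: z :: r) :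
    (E y z → g y + g t = ((z :: r).map fun w => if VStruct E l w then g w else 0).sum) ∧
    (E z y → g z + g t = ((z :: r).map fun w => if VStruct E l w then g w else 0).sum) := by
  induction r generalizing pre y z with
  | nil =>
    obtain rfl : z = t := by simpa [hsplit, List.getLast?_cons] using ht
    have hyz : [y, z] <:+: l := ⟨pre, [], by simp [hsplit]⟩
    have hz : ¬ VStruct E l z := by
      intro hz
      obtain ⟨a, b, hw, -⟩ := vStruct_iff.1 hz
      exact hl.ne_getLast_of_infix ht (infix_right hw) rfl
    have hzz : g z + g z = 0 := CharTwo.add_self_eq_zero _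
    refine ⟨fun h => ?_, fun h => ?_⟩
    · simp [hz, ← h1 y z (Or.inl hyz) h hz, hzz]
    · simp [hz, hzz]
  | cons b r ih =>
    obtain ⟨ih1, ih2⟩ := ih (pre := pre ++ [y]) (y := z) (z := b) (by simp [hsplit])
    have hw : [y, z, b] <:+: l := ⟨pre, r, by simp [hsplit]⟩
    have hzb : GJoined E z b := by
      have := hch.infix (infix_right hw)
      simpa using this
    have hv : VStruct E l z ↔ E y z ∧ E b z := by
      refine ⟨fun hz => ?_, fun hz => vStruct_iff.2 ⟨y, b, hw, hz⟩⟩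
      obtain ⟨a', b', hw', h⟩ := vStruct_iff.1 hz
      rwa [hl.prev_unique (infix_left hw') (infix_left hw),
        hl.next_unique (infix_right hw') (infix_right hw)] at h
    rw [List.map_cons, List.sum_cons]
    rcases hzb with hzb | hbz
    · have hz : ¬ VStruct E l z := fun h => hE.asymm hzb (hv.1 h).2
      rw [if_neg hz, zero_add, ← ih1 hzb]
      exact ⟨fun h => by rw [h1 y z (Or.inl (infix_left hw)) h hz], fun _ => rfl⟩
    · rw [← ih2 hbz]
      refine ⟨fun h => ?_, fun h => ?_⟩
      · rw [if_pos (hv.2 ⟨h, hbz⟩), h2 y z b hw h hbz]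
        have : g b + g b = 0 := CharTwo.add_self_eq_zero _
        linear_combination -this
      · have hz : ¬ VStruct E l z := fun h' => hE.asymm h (hv.1 h').1
        rw [if_neg hz, zero_add, h1 b z (Or.inr (infix_right hw)) hbz hz]

theorem add_eq_sum_colliders [Fintype V] (hE : IsDAG E) [DecidablePred (VStruct E l)]
    (hl : l.Nodup) (hch : l.IsChain (GJoined E)) (g : V → ZMod 2)
    (h1 : ∀ a b, ListAdj l a b → E a b → ¬ VStruct E l b → g b = g a)
    (h2 : ∀ a w b, [a, w, b] <:+: l → E a w → E b w → g w = g a + g b) {s t : V} (hst : t ≠ s)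
    (hs : l.head? = some s) (ht : l.getLast? = some t) :
    g s + g t = ∑ w with VStruct E l w, g w := by
  classical
  obtain ⟨r, hr⟩ := List.head?_eq_some_iff.1 hs
  have hns : ¬ VStruct E l s := by
    intro hz
    obtain ⟨a, b, hw, -⟩ := vStruct_iff.1 hz
    exact hl.ne_head_of_infix hs (infix_left hw) rfl
  have hsum : ∑ w with VStruct E l w, g w =
      (r.map fun w => if VStruct E l w then g w else 0).sum := by
    have hmem : ∀ w, VStruct E l w → w ∈ l := by
      intro w hw
      obtain ⟨a, b, hw, -⟩ := vStruct_iff.1 hw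
      exact hw.subset (by simp)
    calc ∑ w with VStruct E l w, g w = ∑ w ∈ l.toFinset, if VStruct E l w then g w else 0 := by
          rw [← sum_filter]
          refine sum_congr ?_ fun _ _ => rfl
          ext w
          simpa using hmem w
      _ = (l.map fun w => if VStruct E l w then g w else 0).sum := List.sum_toFinset _ hl
      _ = _ := by
          have := congrArg (fun l' => (l'.map fun w => if VStruct E l w then g w else 0).sum) hr
          simpa [hns] using this
  rw [hsum]
  rcases r with _ | ⟨z, r⟩
  · simp [hr] at ht
    exact absurd ht.symm hst
  · have hsz : [s, z] <:+: l := ⟨[], r, by simp [hr]⟩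
    have hj : GJoined E s z := by simpa using hch.infix hsz
    obtain ⟨h3, h4⟩ := add_getLast_eq_sum_colliders hE hl hch g h1 h2 ht (pre := []) hr
    rcases hj with hj | hj
    · exact h3 hj
    · rw [h1 z s (Or.inr hsz) hj hns]
      exact h4 hj

/-- The parents of `v` used by the parity model: the neighbours on `l` pointing to `v` and, off
`l`, the preceding nodes on the paths from the colliders to `S`. -/
def ParityParent (E : V → V → Prop) (S : Set V) (l : List V) (nxt : V → V) (p v : V) : Prop :=
  E p v ∧ (ListAdj l p v ∨
    Downstream E S l nxt v ∧ (VStruct E l p ∨ Downstream E S l nxt p) ∧ p ∉ S ∧ nxt p = v)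

theorem ListAdj.mem_right {a b : V} (h : ListAdj l a b) : b ∈ l := by
  rcases h with h | h <;> exact h.subset (by simp)

theorem parityParent_iff_of_mem {nxt : V → V}
    (hD : ∀ v, Downstream E S l nxt v → v ∉ l) {p v : V}
    (hv : v ∈ l) : ParityParent E S l nxt p v ↔ E p v ∧ ListAdj l p v := by
  have : ¬ Downstream E S l nxt v := fun h => hD v h hv
  simp [ParityParent, this]

theorem parityParent_iff_of_downstream {nxt : V → V}
    (hD : ∀ v, Downstream E S l nxt v → v ∉ l)
    (hnxt : ∀ v, VStruct E l v ∨ Downstream E S l nxt v → v ∉ S → E v (nxt v)) {p v : V}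
    (hv : Downstream E S l nxt v) :
    ParityParent E S l nxt p v ↔
      ((VStruct E l p ∨ Downstream E S l nxt p) ∧ p ∉ S) ∧ nxt p = v := by
  have hl : ¬ ListAdj l p v := fun h => hD v hv h.mem_right
  simp only [ParityParent, hl, hv, false_or, true_and]
  constructor
  · rintro ⟨-, h1, h2, h3⟩
    exact ⟨⟨h1, h2⟩, h3⟩
  · rintro ⟨⟨h1, h2⟩, rfl⟩
    exact ⟨hnxt p h1 h2, h1, h2, rfl⟩

variable [Fintype V] {nxt : V → V}

open Classical in
/-- Every node with parity parents, and every node off `l`, is the sum of its parity parents. -/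
def ParityConfig (E : V → V → Prop) (S : Set V) (l : List V) (nxt : V → V) (g : V → ZMod 2) :
    Prop :=
  ∀ v, (v ∈ l ∧ ∀ p, ¬ ParityParent E S l nxt p v) ∨
    g v = ∑ p with ParityParent E S l nxt p v, g p

theorem parityConfig_indicator (hE : IsDAG E) (hl : l.Nodup)
    (hD : ∀ v, Downstream E S l nxt v → v ∉ l) {g : V → ZMod 2}
    (hg₁ : ∀ v, v ∈ l ∧ ¬ VStruct E l v → g v = 1)
    (hg₀ : ∀ v, ¬ (v ∈ l ∧ ¬ VStruct E l v) → g v = 0) : ParityConfig E S l nxt g := by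
  classical
  intro v
  by_cases hv : v ∈ l
  · have hpar : ∀ p, ParityParent E S l nxt p v ↔ E p v ∧ ListAdj l p v :=
      fun p => parityParent_iff_of_mem hD hv
    simp only [hpar]
    by_cases hvs : VStruct E l v
    · right
      obtain ⟨a, b, hw, ha, hb⟩ := vStruct_iff.1 hvs
      have hab : a ≠ b := by
        have := hl.sublist hw.sublist
        simp only [List.nodup_cons, List.mem_cons] at this
        tauto
      have hset : univ.filter (fun p => E p v ∧ ListAdj l p v) = {a, b} := by
        ext p
        simp only [mem_filter_univ, mem_insert, mem_singleton, listAdj_of_infix hl hw]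
        constructor
        · exact fun h => h.2
        · rintro (rfl | rfl) <;> tauto
      have ha' := not_vStruct_of_listAdj hE hl (Or.inl (infix_left hw)) ha
      have hb' := not_vStruct_of_listAdj hE hl (Or.inr (infix_right hw)) hb
      have hal : a ∈ l := hw.subset (by simp)
      have hbl : b ∈ l := hw.subset (by simp)
      rw [hset, sum_pair hab, hg₁ a ⟨hal, ha'⟩, hg₁ b ⟨hbl, hb'⟩, hg₀ v fun h => h.2 hvs]
      decide
    · by_cases hex : ∃ a, E a v ∧ ListAdj l a v
      · right
        obtain ⟨a, ha, hadj⟩ := hex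
        have hset : univ.filter (fun p => E p v ∧ ListAdj l p v) = {a} := by
          ext p
          simp only [mem_filter_univ, mem_singleton]
          constructor
          · exact fun h => listAdj_unique hl hadj h.2 ha h.1 hvs
          · rintro rfl
            exact ⟨ha, hadj⟩
        have ha' := not_vStruct_of_listAdj hE hl hadj ha
        have hal : a ∈ l := ListAdj.mem_right hadj.symm
        rw [hset, sum_singleton, hg₁ a ⟨hal, ha'⟩, hg₁ v ⟨hv, hvs⟩]
      · exact Or.inl ⟨hv, not_exists.1 hex⟩
  · right
    rw [hg₀ v fun h => hv h.1]
    refine (sum_eq_zero fun p hp => hg₀ p ?_).symm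
    rintro ⟨hpl, hpv⟩
    rw [mem_filter_univ] at hp
    rcases hp.2 with h | ⟨-, h | h, -⟩
    · exact hv h.mem_right
    · exact hpv h
    · exact hD p h hpl

theorem ParityConfig.add_eq_zero (hE : IsDAG E) (hl : l.Nodup) (hch : l.IsChain (GJoined E))
    (hD : ∀ v, Downstream E S l nxt v → v ∉ l)
    (hnxt : ∀ v, VStruct E l v ∨ Downstream E S l nxt v → v ∉ S → E v (nxt v))
    {g : V → ZMod 2} (hg : ParityConfig E S l nxt g) (hgS : ∀ v ∈ S, g v = 0) {s t : V}
    (hst : t ≠ s) (hs : l.head? = some s) (ht : l.getLast? = some t) : g s + g t = 0 := by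
  classical
  have hcl : ∀ v, VStruct E l v → v ∈ l := by
    intro v hv
    obtain ⟨a, b, hw, -⟩ := vStruct_iff.1 hv
    exact hw.subset (by simp)
  rw [add_eq_sum_colliders hE hl hch g ?_ ?_ hst hs ht]
  · have hdown : ∑ v with Downstream E S l nxt v, g v =
        ∑ p with (VStruct E l p ∨ Downstream E S l nxt p) ∧ p ∉ S, g p := by
      rw [← sum_fiberwise_of_maps_to
        (s := univ.filter fun p => (VStruct E l p ∨ Downstream E S l nxt p) ∧ p ∉ S)
        (g := nxt) (t := univ.filter (Downstream E S l nxt ·))]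
      · refine sum_congr rfl fun v hv => ?_
        rw [mem_filter_univ] at hv
        rcases hg v with h | h
        · exact absurd h.1 (hD v hv)
        · rw [h, filter_filter]
          exact sum_congr (filter_congr fun p _ => parityParent_iff_of_downstream hD hnxt hv)
            fun _ _ => rfl
      · intro p hp
        simp only [mem_filter_univ] at hp ⊢
        rcases hp with ⟨h | h, hpS⟩
        · exact .start h hpS
        · exact .step h hpS
    have hS : ∑ p with (VStruct E l p ∨ Downstream E S l nxt p) ∧ p ∉ S, g p =
        ∑ p with VStruct E l p ∨ Downstream E S l nxt p, g p := by
      rw [← filter_filter]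
      refine sum_filter_of_ne fun p _ hp hpS => hp (hgS p hpS)
    have hdisj : Disjoint (univ.filter (VStruct E l ·)) (univ.filter (Downstream E S l nxt ·)) :=
      disjoint_filter.2 fun v _ h1 h2 => hD v h2 (hcl v h1)
    rw [hS, filter_or, sum_union hdisj] at hdown
    simpa using hdown
  · intro a b hadj hab hb
    have hbl := hadj.mem_right
    rcases hg b with ⟨-, h⟩ | h
    · exact absurd ((parityParent_iff_of_mem hD hbl).2 ⟨hab, hadj⟩) (h a)
    · rw [h]
      have hset : univ.filter (fun p => ParityParent E S l nxt p b) = {a} := by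
        ext p
        simp only [mem_filter_univ, mem_singleton, parityParent_iff_of_mem hD hbl]
        constructor
        · exact fun h => listAdj_unique hl hadj h.2 hab h.1 hb
        · rintro rfl
          exact ⟨hab, hadj⟩
      rw [hset, sum_singleton]
  · intro a w b hw ha hb
    have hwl : w ∈ l := hw.subset (by simp)
    rcases hg w with ⟨-, h⟩ | h
    · exact absurd ((parityParent_iff_of_mem hD hwl).2 ⟨ha, Or.inl (infix_left hw)⟩) (h a)
    · have hab : a ≠ b := by
        have := hl.sublist hw.sublist
        simp only [List.nodup_cons, List.mem_cons] at this
        tauto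
      have hset : univ.filter (fun p => ParityParent E S l nxt p w) = {a, b} := by
        ext p
        simp only [mem_filter_univ, mem_insert, mem_singleton, parityParent_iff_of_mem hD hwl,
          listAdj_of_infix hl hw]
        constructor
        · exact fun h => h.2
        · rintro (rfl | rfl) <;> tauto
      rw [h, hset, sum_pair hab]

end ParityModel

theorem dSep_of_forall_factorizes {V : Type*} [Fintype V] [DecidableEq V] {X : V → Type*}
    [∀ v, Fintype (X v)] (h2 : ∀ v, 1 < Fintype.card (X v)) {E E' : V → V → Prop}
    (hE : IsDAG E) (hE' : IsDAG E')
    (h : ∀ p : (∀ v, X v) → ℝ, IsPMF X p → Factorizes X E p → Factorizes X E' p) (s : V) :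
    DSep E {s} ({t | t ≠ s} \ desG E' s) (paG E' s) := by
  classical
  rintro l₀ s' t hl₀ hs₀ ht₀ rfl ⟨hts, hnd⟩
  by_contra hblock
  obtain ⟨hsS, htS, hact⟩ := (not_blockedBy_iff hl₀ hs₀ ht₀).1 hblock
  obtain ⟨l, hl, hmin⟩ := ActiveTrail.exists_minimal ⟨hl₀, hs₀, ht₀, hact⟩
  generalize hS : paG E' s' = S at *
  obtain ⟨nxt, hnxt⟩ := exists_next_ancestralTo E S
  have hspec : ∀ v, Downstream E S l nxt v → AncestralTo E S v ∧ v ∉ l :=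
    fun v hv => hv.spec hE hl hmin hnxt
  have hD : ∀ v, Downstream E S l nxt v → v ∉ l := fun v hv => (hspec v hv).2
  have hnxtE : ∀ v, VStruct E l v ∨ Downstream E S l nxt v → v ∉ S → E v (nxt v) := by
    rintro v (hv | hv) hvS
    · exact (hnxt v (hl.ancestralTo_of_vStruct hv) hvS).1
    · exact (hnxt v (hspec v hv).1 hvS).1
  have hz : ∀ v, ∃ z : X v × X v, z.1 ≠ z.2 := fun v =>
    let ⟨a, b, hab⟩ := Fintype.one_lt_card_iff.1 (h2 v)
    ⟨(a, b), hab⟩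
  choose z hz using hz
  let φ : ∀ v, X v → ZMod 2 := fun v a => if a = (z v).1 then 0 else 1
  have hφ0 : ∀ v, φ v (z v).1 = 0 := fun v => if_pos rfl
  have hφ1 : ∀ v, φ v (z v).2 = 1 := fun v => if_neg (hz v).symm
  have : Nonempty (∀ v, X v) := ⟨fun v => (z v).1⟩
  obtain ⟨p, hp, hpE, hpos⟩ := exists_factorizes_support (X := X) hE
    (fun v a x => (v ∈ l ∧ ∀ p, ¬ ParityParent E S l nxt p v) ∨
      φ v a = ∑ p with ParityParent E S l nxt p v, φ p (x p))
    (by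
      intro v a x y hxy
      have : ∑ p with ParityParent E S l nxt p v, φ p (x p) =
          ∑ p with ParityParent E S l nxt p v, φ p (y p) :=
        sum_congr rfl fun p hp => by rw [hxy p ((mem_filter_univ _).1 hp).1]
      rw [this])
    (by
      intro v x
      have h01 : ∀ c : ZMod 2, c = 0 ∨ c = 1 := by decide
      rcases h01 (∑ p with ParityParent E S l nxt p v, φ p (x p)) with h | h
      · exact ⟨(z v).1, Or.inr (by rw [h, hφ0])⟩
      · exact ⟨(z v).2, Or.inr (by rw [h, hφ1])⟩)
  have hpos' : ∀ x, 0 < p x ↔ ParityConfig E S l nxt fun v => φ v (x v) := hpos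
  let α : ∀ v, X v := fun v => if v ∈ l ∧ ¬ VStruct E l v then (z v).2 else (z v).1
  have hα : ∀ v, φ v (α v) = if v ∈ l ∧ ¬ VStruct E l v then 1 else 0 := by
    intro v
    simp only [α]
    split_ifs
    · exact hφ1 v
    · exact hφ0 v
  have hαpos : 0 < p α := by
    rw [hpos']
    refine parityConfig_indicator hE hl.trail.2.1 hD (fun v hv => ?_) fun v hv => ?_
    · rw [hα, if_pos hv]
    · rw [hα, if_neg hv]
  have hβpos : 0 < p fun v => (z v).1 := by
    rw [hpos']
    simp only [hφ0]
    exact fun v => Or.inr (by simp)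
  have hαS : ∀ v ∈ S, α v = (z v).1 := by
    intro v hv
    refine if_neg fun hvl => hvl.2 ?_
    obtain ⟨a, b, hw⟩ := exists_infix_of_interior hvl.1 hl.head hl.last
      (by rintro rfl; exact hsS hv) (by rintro rfl; exact htS hv)
    exact vStruct_iff.2 ⟨a, b, hw, (hl.active a v b hw).2 hv⟩
  have hmemS : ∀ v, v ∈ S ↔ E' v s' := fun v => by rw [← hS]; rfl
  obtain ⟨x, hx, hxs, hxα⟩ := (h p hp hpE).exists_support_swap hE' (s := s') hβpos hαpos
    fun v hv => (hαS v ((hmemS v).2 hv)).symm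
  have hzero := ParityConfig.add_eq_zero hE hl.trail.2.1 hl.trail.2.2 hD hnxtE
    ((hpos' x).1 hx) (fun v hv => ?_) hts hl.head hl.last
  · have htl : t ∈ l ∧ ¬ VStruct E l t := by
      refine ⟨List.mem_of_getLast? hl.last, fun hv => ?_⟩
      obtain ⟨a, b, hw, -⟩ := vStruct_iff.1 hv
      exact hl.trail.2.1.ne_getLast_of_infix hl.last (infix_right hw) rfl
    rw [hxs, hφ0, hxα t hts hnd, hα, if_pos htl] at hzero
    exact absurd hzero (by decide)
  · have hvs := (hmemS v).1 hv
    have hne : v ≠ s' := by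
      rintro rfl
      exact hE'.irrefl v hvs
    rw [hxα v hne fun hd => hE' s' (hd.tail hvs), hαS v hv, hφ0]

/-- `P^{G'} ⊇ P^G` iff for every node `s`, `s` is d-separated in `G` from its
non-descendants in `G'` given its parents in `G'`. -/
theorem stmt7 {V : Type*} [Fintype V] [DecidableEq V] [Nonempty V]
    (X : V → Type*) [∀ v, Fintype (X v)] (h2 : ∀ v, 1 < Fintype.card (X v))
    (E E' : V → V → Prop) (hE : IsDAG E) (hE' : IsDAG E') :
    (∀ p : (∀ v, X v) → ℝ, IsPMF X p → Factorizes X E p → Factorizes X E' p) ↔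
    (∀ s : V, DSep E {s} ({t | t ≠ s} \ desG E' s) (paG E' s)) := by
  have : ∀ v, Nonempty (X v) := fun v => Fintype.card_pos_iff.1 (zero_lt_one.trans (h2 v))
  exact ⟨fun h s => dSep_of_forall_factorizes h2 hE hE' h s,
    fun h _ hp hpE => factorizes_of_dSep hE hE' h hp hpE⟩
end

section
/- Let G=(N,E) and G'=(N,E') be DAGs on the same node set. If there exists a DAG H=(N,E_H) with E_H ⊆ E' such that H is perfect and the skeleton H^∼ contains the moral graph G^M (i.e. every edge of G^M is an edge of H^∼), then P^{G'} ⊇ P^G. -/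
open Finset

/-- A nonempty finite set of nodes of a DAG contains a node without children in the set. -/
theorem IsDAG.exists_sink {V : Type*} [Finite V] {F : V → V → Prop} (hF : IsDAG F)
    {C : Set V} (hC : C.Nonempty) : ∃ m ∈ C, ∀ a ∈ C, ¬ F m a := by
  let r : V → V → Prop := fun a b => Relation.TransGen F b a
  have : IsTrans V r := ⟨fun _ _ _ hab hbc => Relation.TransGen.trans hbc hab⟩
  have : Std.Irrefl r := ⟨fun a => hF a⟩
  obtain ⟨m, hm, hmin⟩ := (Finite.wellFounded_of_trans_of_irrefl r).has_min C hC
  exact ⟨m, hm, fun a ha hma => hmin a ha (Relation.TransGen.single hma)⟩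

/-- A nonempty complete set of a DAG is contained in the family of one of its members. -/
theorem IsDAG.exists_family {V : Type*} [Finite V] {F : V → V → Prop} (hF : IsDAG F)
    {C : Set V} (hC : C.Nonempty) (hcomp : GComplete F C) :
    ∃ m ∈ C, ∀ a ∈ C, a ≠ m → F a m := by
  obtain ⟨m, hm, hsink⟩ := hF.exists_sink hC
  exact ⟨m, hm, fun a ha hne => (hcomp a ha m hm hne).resolve_right (hsink a ha)⟩

/-- Induction over the parent-closed sets of nodes of a DAG, adding one sink at a time. -/
theorem IsDAG.parentClosed_induction {V : Type*} [Finite V] [DecidableEq V]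
    {F : V → V → Prop} (hF : IsDAG F) {P : Finset V → Prop} (empty : P ∅)
    (step : ∀ S t, t ∉ S → (∀ s ∈ S, ¬ F t s) → (∀ u, F u t → u ∈ S) → P S → P (insert t S))
    (S : Finset V) (hS : ∀ s ∈ S, ∀ u, F u s → u ∈ S) : P S := by
  induction S using Finset.strongInduction with
  | H S ih =>
    rcases S.eq_empty_or_nonempty with rfl | hne
    · exact empty
    · obtain ⟨t, ht, hsink⟩ := hF.exists_sink (C := (S : Set V)) hne
      have ht' : t ∈ S := ht
      rw [← Finset.insert_erase ht']
      refine step _ t (Finset.notMem_erase t S)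
        (fun s hs => hsink s (Finset.mem_of_mem_erase hs))
        (fun u hu => Finset.mem_erase.2 ⟨?_, hS t ht' u hu⟩)
        (ih _ (Finset.erase_ssubset ht') fun s hs u hu => Finset.mem_erase.2
          ⟨?_, hS s (Finset.mem_of_mem_erase hs) u hu⟩)
      · rintro rfl
        exact hF u (Relation.TransGen.single hu)
      · rintro rfl
        exact hsink s (Finset.mem_of_mem_erase hs) hu

/-- Resampling one coordinate multiplies a sum over configurations by the size of the
state space of that coordinate. -/
theorem sum_sum_update {V : Type*} [Fintype V] [DecidableEq V] {X : V → Type*}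
    [∀ v, Fintype (X v)] (t : V) (h : (∀ v, X v) → ℝ) :
    ∑ x, ∑ a, h (Function.update x t a) = Fintype.card (X t) * ∑ x, h x := by
  have key : ∑ z : (∀ v, X v) × X t, h (Function.update z.1 t z.2)
      = ∑ z : (∀ v, X v) × X t, h z.1 :=
    Finset.sum_bij' (fun z _ => (Function.update z.1 t z.2, z.1 t))
      (fun z _ => (Function.update z.1 t z.2, z.1 t)) (by simp) (by simp) (by simp) (by simp)
      (by simp)
  rw [Fintype.sum_prod_type, Fintype.sum_prod_type] at key
  simpa [Finset.mul_sum] using key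

/-- The total mass of a product of kernels over a parent-closed set of nodes. -/
theorem sum_prod_kernel {V : Type*} [Fintype V] [DecidableEq V] {X : V → Type*}
    [∀ v, Fintype (X v)] [∀ v, Nonempty (X v)] {F : V → V → Prop} (hF : IsDAG F)
    {k : ∀ s, X s → (∀ v, X v) → ℝ} (hk : ∀ s, IsKernel X F s (k s))
    (S : Finset V) (hS : ∀ s ∈ S, ∀ u, F u s → u ∈ S) :
    (∏ s ∈ S, (Fintype.card (X s) : ℝ)) * ∑ x, ∏ s ∈ S, k s (x s) x
      = ∏ s, (Fintype.card (X s) : ℝ) := by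
  refine hF.parentClosed_induction (P := fun S => (∏ s ∈ S, (Fintype.card (X s) : ℝ)) *
    ∑ x, ∏ s ∈ S, k s (x s) x = ∏ s, (Fintype.card (X s) : ℝ)) ?_ ?_ S hS
  · simp
  · intro S t htS hsink _ ih
    rw [← ih, Finset.prod_insert htS, mul_comm (Fintype.card (X t) : ℝ), mul_assoc,
      ← sum_sum_update]
    congr 1
    refine Finset.sum_congr rfl fun x _ => ?_
    have hself : ¬ F t t := fun h => hF t (Relation.TransGen.single h)
    have hterm : ∀ a, ∏ s ∈ insert t S, k s (Function.update x t a s) (Function.update x t a)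
        = k t a x * ∏ s ∈ S, k s (x s) x := by
      intro a
      rw [Finset.prod_insert htS, Function.update_self]
      congr 1
      · refine (hk t).2.1 a _ _ fun u hu => Function.update_of_ne ?_ _ _
        rintro rfl
        exact hself hu
      · refine Finset.prod_congr rfl fun s hs => ?_
        rw [Function.update_of_ne (ne_of_mem_of_not_mem hs htS)]
        refine (hk s).2.1 _ _ _ fun u hu => Function.update_of_ne ?_ _ _
        rintro rfl
        exact hsink s hs hu
    simp_rw [hterm]
    rw [← Finset.sum_mul, (hk t).2.2 x, one_mul]

/-- A nonnegative function on the configurations of a family is the product of a kernel and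
of a nonnegative function on the configurations of the parents. -/
theorem exists_kernel_mul {V : Type*} [DecidableEq V] {X : V → Type*}
    [∀ v, Fintype (X v)] [∀ v, Nonempty (X v)] {F : V → V → Prop} {t : V} (hself : ¬ F t t)
    {f : (∀ v, X v) → ℝ} (hf : ∀ x, 0 ≤ f x)
    (hloc : ∀ x y, x t = y t → (∀ u, F u t → x u = y u) → f x = f y) :
    ∃ (k : X t → (∀ v, X v) → ℝ) (g : (∀ v, X v) → ℝ), IsKernel X F t k ∧ (∀ x, 0 ≤ g x) ∧
      (∀ x y, (∀ u, F u t → x u = y u) → g x = g y) ∧ ∀ x, f x = k (x t) x * g x := by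
  classical
  have hupd : ∀ a x y, (∀ u, F u t → x u = y u) →
      f (Function.update x t a) = f (Function.update y t a) := by
    intro a x y hxy
    refine hloc _ _ (by simp) fun u hu => ?_
    have hut : u ≠ t := by
      rintro rfl
      exact hself hu
    simp [hut, hxy u hu]
  let g : (∀ v, X v) → ℝ := fun x => ∑ a, f (Function.update x t a)
  have hg0 : ∀ x, 0 ≤ g x := fun x => Finset.sum_nonneg fun a _ => hf _
  have hgloc : ∀ x y, (∀ u, F u t → x u = y u) → g x = g y := fun x y hxy =>
    Finset.sum_congr rfl fun a _ => hupd a x y hxy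
  refine ⟨fun a x => if g x = 0 then (Fintype.card (X t) : ℝ)⁻¹
    else f (Function.update x t a) / g x, g, ⟨?_, ?_, ?_⟩, hg0, hgloc, ?_⟩
  · intro a x
    dsimp only
    split_ifs
    · positivity
    · exact div_nonneg (hf _) (hg0 x)
  · intro a x y hxy
    simp only [hgloc x y hxy, hupd a x y hxy]
  · intro x
    by_cases h : g x = 0
    · simp [h]
    · simp only [h, if_false]
      rw [← Finset.sum_div]
      exact div_self h
  · intro x
    by_cases h : g x = 0
    · have := (Finset.sum_eq_zero_iff_of_nonneg fun a _ => hf _).1 h (x t) (Finset.mem_univ _)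
      rw [Function.update_eq_self] at this
      rw [this, h, mul_zero]
    · simp [h]

/-- Over a perfect DAG, a product of nonnegative functions on the configurations of families
is proportional to a product of kernels. -/
theorem exists_kernels_of_potentials {V : Type*} [Fintype V] [DecidableEq V] {X : V → Type*}
    [∀ v, Fintype (X v)] [∀ v, Nonempty (X v)] {F : V → V → Prop} (hF : IsDAG F)
    (hperf : GPerfect F) (S : Finset V) (hS : ∀ s ∈ S, ∀ u, F u s → u ∈ S)
    (φ : V → (∀ v, X v) → ℝ) (hφ : ∀ s x, 0 ≤ φ s x)
    (hloc : ∀ s x y, x s = y s → (∀ u, F u s → x u = y u) → φ s x = φ s y) :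
    ∃ (c : ℝ) (k : ∀ s, X s → (∀ v, X v) → ℝ), (∀ s ∈ S, IsKernel X F s (k s)) ∧
      ∀ x, ∏ s ∈ S, φ s x = c * ∏ s ∈ S, k s (x s) x := by
  revert φ
  refine hF.parentClosed_induction (P := fun S => ∀ φ : V → (∀ v, X v) → ℝ,
    (∀ s x, 0 ≤ φ s x) →
    (∀ s x y, x s = y s → (∀ u, F u s → x u = y u) → φ s x = φ s y) →
    ∃ (c : ℝ) (k : ∀ s, X s → (∀ v, X v) → ℝ), (∀ s ∈ S, IsKernel X F s (k s)) ∧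
      ∀ x, ∏ s ∈ S, φ s x = c * ∏ s ∈ S, k s (x s) x) ?_ ?_ S hS
  · intro φ _ _
    exact ⟨1, fun _ _ _ => 0, by simp, by simp⟩
  · intro S t htS _ hpa ih φ hφ hloc
    obtain ⟨kt, g, hkt, hg0, hgloc, hfac⟩ := exists_kernel_mul
      (fun h => hF t (Relation.TransGen.single h)) (hφ t) (hloc t)
    suffices ∃ (c : ℝ) (k : ∀ s, X s → (∀ v, X v) → ℝ), (∀ s ∈ S, IsKernel X F s (k s)) ∧
        ∀ x, g x * ∏ s ∈ S, φ s x = c * ∏ s ∈ S, k s (x s) x by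
      obtain ⟨c, k, hk, hprod⟩ := this
      refine ⟨c, Function.update k t kt, ?_, fun x => ?_⟩
      · intro s hs
        rcases Finset.mem_insert.1 hs with rfl | hs
        · simpa using hkt
        · simpa [ne_of_mem_of_not_mem hs htS] using hk s hs
      · have hcongr : ∏ s ∈ S, Function.update k t kt s (x s) x = ∏ s ∈ S, k s (x s) x :=
          Finset.prod_congr rfl fun s hs => by
            rw [Function.update_of_ne (ne_of_mem_of_not_mem hs htS)]
        rw [Finset.prod_insert htS, Finset.prod_insert htS, hcongr, Function.update_self,
          hfac x, mul_assoc, hprod x]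
        ring
    by_cases hne : (paG F t).Nonempty
    · obtain ⟨m, hm, hfam⟩ := hF.exists_family hne (hperf t)
      obtain ⟨c, k, hk, hprod⟩ := ih (fun s x => φ s x * if s = m then g x else 1)
        (fun s x => mul_nonneg (hφ s x) (by split_ifs; exacts [hg0 x, zero_le_one]))
        (by
          intro s x y hs hu
          rw [hloc s x y hs hu]
          split_ifs with hsm
          · subst hsm
            rw [hgloc x y fun u hut => ?_]
            by_cases hus : u = s
            · rw [hus, hs]
            · exact hu u (hfam u hut hus)
          · rfl)
      refine ⟨c, k, hk, fun x => ?_⟩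
      rw [← hprod x, Finset.prod_mul_distrib, Finset.prod_ite_eq', if_pos (hpa m hm), mul_comm]
    · obtain ⟨c, k, hk, hprod⟩ := ih φ hφ hloc
      have x₀ : ∀ v, X v := fun v => Classical.arbitrary _
      refine ⟨g x₀ * c, k, hk, fun x => ?_⟩
      rw [hprod x, hgloc x x₀ fun u hu => absurd ⟨u, hu⟩ hne, mul_assoc]

/-- Kernels remain kernels when edges are added to the graph. -/
theorem IsKernel.mono {V : Type*} {X : V → Type*} [∀ v, Fintype (X v)] {F E : V → V → Prop}
    (h : ∀ a b, F a b → E a b) {s : V} {k : X s → (∀ v, X v) → ℝ} (hk : IsKernel X F s k) :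
    IsKernel X E s k :=
  ⟨hk.1, fun a x y hxy => hk.2.1 a x y fun t ht => hxy t (h t s ht), hk.2.2⟩

/-- The families of a graph are complete in any graph whose skeleton contains the moral
graph. -/
theorem gcomplete_family {V : Type*} {E F : V → V → Prop}
    (h : ∀ a b, MoralEdge E a b → GJoined F a b) (s : V) :
    GComplete F (insert s (paG E s)) := by
  rintro a (rfl | ha) b (rfl | hb) hab
  · exact absurd rfl hab
  · exact h _ _ (Or.inr (Or.inl hb))
  · exact h _ _ (Or.inl ha)
  · exact h _ _ (Or.inr (Or.inr ⟨hab, s, ha, hb⟩))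

/-- if `G'` contains a perfect subgraph `H` whose skeleton contains the moral
graph of `G`, then `P^{G'} ⊇ P^G`. -/
theorem stmt9 {V : Type*} [Fintype V] [DecidableEq V] [Nonempty V]
    (X : V → Type*) [∀ v, Fintype (X v)] [∀ v, Nonempty (X v)]
    (E E' : V → V → Prop) (hE : IsDAG E) (hE' : IsDAG E')
    (h : ∃ F : V → V → Prop, (∀ a b, F a b → E' a b) ∧ IsDAG F ∧ GPerfect F ∧
      ∀ a b, MoralEdge E a b → GJoined F a b) :
    ∀ p : (∀ v, X v) → ℝ, IsPMF X p → Factorizes X E p → Factorizes X E' p := by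
  intro p hp hpE
  obtain ⟨F, hFE', hF, hperf, hmoral⟩ := h
  obtain ⟨k, hk, hpk⟩ := hpE
  choose m _ hm using fun s =>
    hF.exists_family (Set.insert_nonempty s (paG E s)) (gcomplete_family hmoral s)
  obtain ⟨c, l, hl, hprod⟩ := exists_kernels_of_potentials hF hperf Finset.univ (by simp)
    (fun t x => ∏ s with m s = t, k s (x s) x)
    (fun t x => Finset.prod_nonneg fun s _ => (hk s).1 _ _)
    (by
      intro t x y ht hu
      refine Finset.prod_congr rfl fun s hs => ?_
      have hst : m s = t := (Finset.mem_filter.1 hs).2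
      have hagree : ∀ a ∈ insert s (paG E s), x a = y a := by
        intro a ha
        by_cases hat : a = t
        · rw [hat, ht]
        · exact hu a (hst ▸ hm s a ha (hst ▸ hat))
      rw [hagree s (Set.mem_insert _ _)]
      exact (hk s).2.1 _ _ _ fun u hu => hagree u (Set.mem_insert_of_mem _ hu))
  have hpl : ∀ x, p x = c * ∏ s, l s (x s) x := fun x => by
    rw [← hprod x, hpk x, Finset.prod_fiberwise]
  have hl' : ∀ s, IsKernel X F s (l s) := fun s => hl s (Finset.mem_univ s)
  have hmass : ∑ x, ∏ s, l s (x s) x = 1 := by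
    have hcard : (∏ s, (Fintype.card (X s) : ℝ)) ≠ 0 :=
      Finset.prod_ne_zero_iff.2 fun s _ => Nat.cast_ne_zero.2 Fintype.card_ne_zero
    exact mul_left_cancel₀ hcard
      ((sum_prod_kernel hF hl' Finset.univ (by simp)).trans (mul_one _).symm)
  have hc : c = 1 := by
    have := hp.2
    simp_rw [hpl] at this
    rwa [← Finset.mul_sum, hmass, mul_one] at this
  exact ⟨l, fun s => (hl' s).mono hFE', fun x => by rw [hpl x, hc, one_mul]⟩
end
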